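/- Let d ≥ 1 and define the homogeneous weight w₄(z,t) = |z| (|z|⁴+t²)^{−1/2}. There exists a constant C > 0 depending only on d such that for every σ ∈ ℂ with Im σ ≠ 0 and every f ∈ 𝒮(ℝ^{2d+1}) satisfying N f ≡ 0 on ℝ^{2d+1}, one has ∫ w₄(z,t)² |f(z,t)|² dz dt ≤ C ∫ w₄(z,t)^{−2} |Δ_H f(z,t) + σ f(z,t)|² dz dt. This is the uniform resolvent estimate ‖w₄ (L−σ)^{−1} w₄‖ ≤ C^{1/2} on Ker N, L = −Δ_H, in a priori form on Schwartz functions. -/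

import Mathlib

noncomputable section

open MeasureTheory ENNReal

/-- The Heisenberg group ℍ^d modeled on ℝ^d × ℝ^d × ℝ. -/
abbrev Hd (d : ℕ) : Type := EuclideanSpace ℝ (Fin d) × EuclideanSpace ℝ (Fin d) × ℝ

/-- The left-invariant vector field `X_j = ∂_{x_j} + 2 y_j ∂_t`. -/
def Xop (d : ℕ) (j : Fin d) (f : Hd d → ℂ) (p : Hd d) : ℂ :=
  fderiv ℝ f p (EuclideanSpace.single j 1, 0, 2 * p.2.1 j)

/-- The left-invariant vector field `Y_j = ∂_{y_j} - 2 x_j ∂_t`. -/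
def Yop (d : ℕ) (j : Fin d) (f : Hd d → ℂ) (p : Hd d) : ℂ :=
  fderiv ℝ f p (0, EuclideanSpace.single j 1, -(2 * p.1 j))

/-- The vertical derivative `T = ∂_t`. -/
def Tder (d : ℕ) (f : Hd d → ℂ) (p : Hd d) : ℂ :=
  fderiv ℝ f p (0, 0, 1)

/-- The rotation operator `N = Σ_j (y_j ∂_{x_j} - x_j ∂_{y_j})`. -/
def Nop (d : ℕ) (f : Hd d → ℂ) (p : Hd d) : ℂ :=
  fderiv ℝ f p (p.2.1, -p.1, 0)

/-- The sublaplacian `Δ_H = Σ_j (X_j² + Y_j²)`. -/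
def subLap (d : ℕ) (f : Hd d → ℂ) (p : Hd d) : ℂ :=
  ∑ j : Fin d, (Xop d j (Xop d j f) p + Yop d j (Yop d j f) p)

/-- Squared length of the horizontal gradient: `|∇_H f|² = Σ_j (|X_j f|² + |Y_j f|²)`. -/
def gradHsq (d : ℕ) (f : Hd d → ℂ) (p : Hd d) : ℝ :=
  ∑ j : Fin d, (‖Xop d j f p‖ ^ 2 + ‖Yop d j f p‖ ^ 2)

/-- `|z|² = |x|² + |y|²`. -/
def zsq (d : ℕ) (p : Hd d) : ℝ := ‖p.1‖ ^ 2 + ‖p.2.1‖ ^ 2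

/-- `|z|`. -/
def zn (d : ℕ) (p : Hd d) : ℝ := Real.sqrt (zsq d p)

/-- The weight `w₁(z,t) = |z| (1+|z|²)^{-1/2} (1 + (|z|⁴+t²)^{1/2})⁻¹`. -/
def w1 (d : ℕ) (p : Hd d) : ℝ :=
  zn d p / Real.sqrt (1 + zn d p ^ 2) / (1 + Real.sqrt (zn d p ^ 4 + p.2.2 ^ 2))

/-- The weight `w₂(z,t) = (1+|z|²+t²)^{-1/2}`. -/
def w2 (d : ℕ) (p : Hd d) : ℝ :=
  (Real.sqrt (1 + zsq d p + p.2.2 ^ 2))⁻¹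

/-- The weight `w₄(z,t) = |z| (|z|⁴+t²)^{-1/2}`. -/
def w4 (d : ℕ) (p : Hd d) : ℝ :=
  zn d p / Real.sqrt (zn d p ^ 4 + p.2.2 ^ 2)

section Abstract

open scoped InnerProductSpace ComplexConjugate

variable {V H E : Type*} [NormedAddCommGroup V] [InnerProductSpace ℂ V] [CompleteSpace V]
  [NormedAddCommGroup H] [InnerProductSpace ℂ H] [CompleteSpace H]
  [NormedAddCommGroup E] [InnerProductSpace ℂ E]

/-- The operator `1 - (1 + σ) J* J`, i.e. the form `⟪G u, G v⟫ - σ ⟪J u, J v⟫` when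
`⟪u, v⟫ = ⟪J u, J v⟫ + ⟪G u, G v⟫`. -/
def formOp (J : V →L[ℂ] H) (σ : ℂ) : V →L[ℂ] V :=
  1 - (1 + σ) • (J.adjoint ∘L J)

/-- The resolvent associated with `formOp`. -/
def formRes (J : V →L[ℂ] H) (σ : ℂ) : V →L[ℂ] V := Ring.inverse (formOp J σ)

theorem isUnit_formOp (J : V →L[ℂ] H) {σ : ℂ} (hσ : σ.im ≠ 0) : IsUnit (formOp J σ) := by
  have h1 : (1 + σ) ≠ 0 := fun h => hσ (by simpa using congrArg Complex.im h)
  have hsa : IsSelfAdjoint (J.adjoint ∘L J) := by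
    rw [ContinuousLinearMap.isSelfAdjoint_iff_isSymmetric]
    intro x y
    simp [ContinuousLinearMap.adjoint_inner_left, ContinuousLinearMap.adjoint_inner_right]
  have hns : (1 + σ)⁻¹ ∉ spectrum ℂ (J.adjoint ∘L J) := by
    intro h
    have := hsa.im_eq_zero_of_mem_spectrum h
    rw [Complex.inv_im] at this
    rcases div_eq_zero_iff.1 this with h | h
    · exact hσ (by simpa using h)
    · exact h1 (by simpa using h)
  have hu := spectrum.notMem_iff.1 hns
  have : formOp J σ = (Units.mk0 _ h1) •
      (algebraMap ℂ (V →L[ℂ] V) (1 + σ)⁻¹ - (J.adjoint ∘L J)) := by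
    rw [formOp, Units.smul_def, smul_sub, Units.val_mk0, Algebra.algebraMap_eq_smul_one, smul_smul,
      mul_inv_cancel₀ h1, one_smul]
  rw [this]
  exact hu.smul _

theorem inner_formOp {J : V →L[ℂ] H} {G : V →L[ℂ] E}
    (hV : ∀ u v : V, ⟪u, v⟫_ℂ = ⟪J u, J v⟫_ℂ + ⟪G u, G v⟫_ℂ) (σ : ℂ) (w u : V) :
    ⟪w, formOp J σ u⟫_ℂ = ⟪G w, G u⟫_ℂ - σ * ⟪J w, J u⟫_ℂ := by
  have h : formOp J σ u = u - (1 + σ) • J.adjoint (J u) := rfl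
  rw [h, inner_sub_right, inner_smul_right, ContinuousLinearMap.adjoint_inner_right, hV]
  ring

theorem inner_formRes {J : V →L[ℂ] H} {G : V →L[ℂ] E}
    (hV : ∀ u v : V, ⟪u, v⟫_ℂ = ⟪J u, J v⟫_ℂ + ⟪G u, G v⟫_ℂ) {σ : ℂ} (hσ : σ.im ≠ 0) (w γ : V) :
    ⟪G w, G (formRes J σ γ)⟫_ℂ - σ * ⟪J w, J (formRes J σ γ)⟫_ℂ = ⟪w, γ⟫_ℂ := by
  rw [← inner_formOp hV]
  congr 1
  change (formOp J σ * formRes J σ) γ = γ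
  rw [formRes, Ring.mul_inverse_cancel _ (isUnit_formOp J hσ)]
  rfl

theorem eq_formRes {J : V →L[ℂ] H} {G : V →L[ℂ] E}
    (hV : ∀ u v : V, ⟪u, v⟫_ℂ = ⟪J u, J v⟫_ℂ + ⟪G u, G v⟫_ℂ) {σ : ℂ} (hσ : σ.im ≠ 0) {u γ : V}
    (h : ∀ w, ⟪G w, G u⟫_ℂ - σ * ⟪J w, J u⟫_ℂ = ⟪w, γ⟫_ℂ) : u = formRes J σ γ := by
  have : formOp J σ u = γ := ext_inner_left ℂ fun w => by rw [inner_formOp hV, h]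
  rw [← this]
  change u = (formRes J σ * formOp J σ) u
  rw [formRes, Ring.inverse_mul_cancel _ (isUnit_formOp J hσ)]
  rfl

theorem inner_formRes_conj {J : V →L[ℂ] H} {G : V →L[ℂ] E}
    (hV : ∀ u v : V, ⟪u, v⟫_ℂ = ⟪J u, J v⟫_ℂ + ⟪G u, G v⟫_ℂ) {σ : ℂ} (hσ : σ.im ≠ 0) (γ γ' : V) :
    ⟪γ', formRes J σ γ⟫_ℂ = ⟪formRes J (conj σ) γ', γ⟫_ℂ := by
  have h1 := inner_formRes hV hσ (formRes J (conj σ) γ') γ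
  have h2 := inner_formRes hV (σ := conj σ) (by simpa using hσ) (formRes J σ γ) γ'
  have h3 := congrArg conj h2
  simp only [map_sub, map_mul, inner_conj_symm, Complex.conj_conj] at h3
  rw [← h1, ← h3]

/-- `Im (σ ⟪γ, R(σ) γ⟫) = Im σ ‖G R(σ) γ‖²`. -/
theorem im_mul_inner_formRes {J : V →L[ℂ] H} {G : V →L[ℂ] E}
    (hV : ∀ u v : V, ⟪u, v⟫_ℂ = ⟪J u, J v⟫_ℂ + ⟪G u, G v⟫_ℂ) {σ : ℂ} (hσ : σ.im ≠ 0) (γ : V) :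
    (σ * ⟪γ, formRes J σ γ⟫_ℂ).im = σ.im * ‖G (formRes J σ γ)‖ ^ 2 := by
  have h := congrArg conj (inner_formRes hV hσ (formRes J σ γ) γ)
  simp only [map_sub, map_mul, inner_conj_symm, inner_self_eq_norm_sq_to_K] at h
  rw [← h]
  have e1 : ∀ r : ℝ, ((r : ℂ) ^ 2) = ((r ^ 2 : ℝ) : ℂ) := fun r => by push_cast; rfl
  simp [e1, Complex.mul_im, Complex.mul_re, -Complex.ofReal_pow]
  ring

theorem norm_formRes_conj {J : V →L[ℂ] H} {G : V →L[ℂ] E}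
    (hV : ∀ u v : V, ⟪u, v⟫_ℂ = ⟪J u, J v⟫_ℂ + ⟪G u, G v⟫_ℂ) {σ : ℂ} (hσ : σ.im ≠ 0) (γ : V) :
    ‖G (formRes J (conj σ) γ)‖ = ‖G (formRes J σ γ)‖ := by
  have hσ' : (conj σ).im ≠ 0 := by simpa using hσ
  have h1 := im_mul_inner_formRes hV hσ γ
  have h2 := im_mul_inner_formRes hV hσ' γ
  rw [inner_formRes_conj hV hσ', Complex.conj_conj, ← inner_conj_symm, ← map_mul, Complex.conj_im,
    h1, Complex.conj_im, neg_mul, neg_inj] at h2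
  have := mul_left_cancel₀ hσ h2
  exact ((pow_left_inj₀ (norm_nonneg _) (norm_nonneg _) two_ne_zero).1 this).symm

theorem norm_formRes_sq_le {J : V →L[ℂ] H} {G : V →L[ℂ] E}
    (hV : ∀ u v : V, ⟪u, v⟫_ℂ = ⟪J u, J v⟫_ℂ + ⟪G u, G v⟫_ℂ) {σ : ℂ} (hσ : 0 < σ.im) (γ : V) :
    ‖G (formRes J σ γ)‖ ^ 2 ≤ ‖σ * ⟪γ, formRes J σ γ⟫_ℂ‖ / σ.im := by
  rw [le_div_iff₀ hσ, mul_comm, ← im_mul_inner_formRes hV hσ.ne']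
  exact (le_abs_self _).trans (Complex.abs_im_le_norm _)

theorem norm_mul_inner_formRes_le {J : V →L[ℂ] H} {G : V →L[ℂ] E}
    (hV : ∀ u v : V, ⟪u, v⟫_ℂ = ⟪J u, J v⟫_ℂ + ⟪G u, G v⟫_ℂ) {σ : ℂ} (hσ : 0 < σ.im) {γ : V} {M : ℝ}
    (hγ : ∀ v, ‖⟪γ, v⟫_ℂ‖ ≤ M * ‖G v‖) :
    ‖σ * ⟪γ, formRes J σ γ⟫_ℂ‖ ≤ M ^ 2 * ‖σ‖ ^ 2 / σ.im := by
  set P := ‖σ * ⟪γ, formRes J σ γ⟫_ℂ‖ with hP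
  have h1 : P ≤ ‖σ‖ * (M * ‖G (formRes J σ γ)‖) := by
    rw [hP, norm_mul]; gcongr; exact hγ _
  have h2 := norm_formRes_sq_le hV hσ γ
  rw [← hP] at h2
  have hP0 : 0 ≤ P := norm_nonneg _
  rcases hP0.eq_or_lt with h | h
  · rw [← h]; positivity
  have h3 : P ^ 2 ≤ M ^ 2 * ‖σ‖ ^ 2 / σ.im * P := by
    calc P ^ 2 ≤ (‖σ‖ * (M * ‖G (formRes J σ γ)‖)) ^ 2 := by gcongr
      _ = ‖σ‖ ^ 2 * M ^ 2 * ‖G (formRes J σ γ)‖ ^ 2 := by ring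
      _ ≤ ‖σ‖ ^ 2 * M ^ 2 * (P / σ.im) := by gcongr
      _ = _ := by ring
  rw [sq P] at h3
  exact le_of_mul_le_mul_right h3 h

theorem differentiableAt_formRes (J : V →L[ℂ] H) {σ : ℂ} (hσ : σ.im ≠ 0) :
    DifferentiableAt ℂ (formRes J) σ := by
  obtain ⟨x, hx⟩ := isUnit_formOp J hσ
  have h1 : DifferentiableAt ℂ Ring.inverse (formOp J σ) := by
    rw [← hx]; exact (hasFDerivAt_ringInverse (𝕜 := ℂ) x).differentiableAt
  have h2 : DifferentiableAt ℂ (formOp J) σ := by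
    unfold formOp; fun_prop
  exact h1.comp σ h2

theorem differentiableAt_mul_inner_formRes (J : V →L[ℂ] H) {σ : ℂ} (hσ : σ.im ≠ 0) (γ : V) :
    DifferentiableAt ℂ (fun σ => σ * ⟪γ, formRes J σ γ⟫_ℂ) σ := by
  have h1 : DifferentiableAt ℂ (fun σ => formRes J σ γ) σ :=
    (differentiableAt_formRes J hσ).clm_apply (differentiableAt_const γ)
  have h2 : DifferentiableAt ℂ (fun σ => innerSL ℂ γ (formRes J σ γ)) σ :=
    (innerSL ℂ γ).differentiableAt.comp σ h1
  exact differentiableAt_id.mul h2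

/-- The one-parameter group `D` scales the form `⟪J ·, J ·⟫` trivially and the form `⟪G ·, G ·⟫`
by `e^{2s}`. -/
structure IsDilation (J : V →L[ℂ] H) (G : V →L[ℂ] E) (D : ℝ → V →L[ℂ] V) : Prop where
  apply_neg : ∀ s v, D s (D (-s) v) = v
  inner_left : ∀ s u v, ⟪J (D s u), J (D s v)⟫_ℂ = ⟪J u, J v⟫_ℂ
  inner_right : ∀ s u v, ⟪G (D s u), G (D s v)⟫_ℂ = (Real.exp (2 * s) : ℂ) * ⟪G u, G v⟫_ℂ

theorem IsDilation.norm_apply {J : V →L[ℂ] H} {G : V →L[ℂ] E} {D : ℝ → V →L[ℂ] V}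
    (hD : IsDilation J G D) (s : ℝ) (u : V) : ‖G (D s u)‖ = Real.exp s * ‖G u‖ := by
  have h := hD.inner_right s u u
  rw [inner_self_eq_norm_sq_to_K, inner_self_eq_norm_sq_to_K] at h
  have h' : ‖G (D s u)‖ ^ 2 = Real.exp (2 * s) * ‖G u‖ ^ 2 :=
    Complex.ofReal_injective (by push_cast at h ⊢; exact h)
  rw [two_mul, Real.exp_add, ← sq, ← mul_pow] at h'
  exact (pow_left_inj₀ (norm_nonneg _) (by positivity) two_ne_zero).1 h'

theorem IsDilation.formRes_eq {J : V →L[ℂ] H} {G : V →L[ℂ] E} {D : ℝ → V →L[ℂ] V}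
    (hV : ∀ u v : V, ⟪u, v⟫_ℂ = ⟪J u, J v⟫_ℂ + ⟪G u, G v⟫_ℂ) (hD : IsDilation J G D)
    {σ : ℂ} (hσ : σ.im ≠ 0) (s : ℝ) (γ : V) :
    (Real.exp (2 * s) : ℂ) • D (-s) (formRes J σ γ) =
      formRes J ((Real.exp (-(2 * s)) : ℝ) * σ) ((D s).adjoint γ) := by
  have he : (Real.exp (2 * s) : ℂ) * (Real.exp (-(2 * s)) : ℝ) = 1 := by
    rw [← Complex.ofReal_mul, ← Real.exp_add]; simp
  refine eq_formRes hV (by rw [Complex.im_ofReal_mul]; exact mul_ne_zero (Real.exp_pos _).ne' hσ)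
    fun w => ?_
  rw [ContinuousLinearMap.adjoint_inner_right, ← inner_formRes hV hσ, map_smul, map_smul,
    inner_smul_right, inner_smul_right]
  have h1 := hD.inner_left s w (D (-s) (formRes J σ γ))
  have h2 := hD.inner_right s w (D (-s) (formRes J σ γ))
  rw [hD.apply_neg] at h1 h2
  rw [h1, h2]
  linear_combination (- σ * ⟪J w, J (D (-s) (formRes J σ γ))⟫_ℂ) * he

theorem IsDilation.norm_sub_le {J : V →L[ℂ] H} {G : V →L[ℂ] E} {D : ℝ → V →L[ℂ] V}
    (hV : ∀ u v : V, ⟪u, v⟫_ℂ = ⟪J u, J v⟫_ℂ + ⟪G u, G v⟫_ℂ) (hD : IsDilation J G D)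
    {σ : ℂ} (hσ : σ.im ≠ 0) {s : ℝ} {γ : V} {M : ℝ}
    (hγ : ∀ v, ‖⟪γ, D s v⟫_ℂ - ⟪γ, v⟫_ℂ‖ ≤ M * |s| * ‖G v‖) :
    ‖⟪γ, formRes J ((Real.exp (-(2 * s)) : ℝ) * σ) γ⟫_ℂ
        - (Real.exp (2 * s) : ℂ) * ⟪γ, formRes J σ γ⟫_ℂ‖ ≤
      M * |s| * (‖G (formRes J ((Real.exp (-(2 * s)) : ℝ) * σ) γ)‖
        + Real.exp s * ‖G (formRes J σ γ)‖) := by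
  set σ' : ℂ := (Real.exp (-(2 * s)) : ℝ) * σ with hσ'
  set δ := (D s).adjoint γ with hδ
  have hσ'0 : σ'.im ≠ 0 := by
    rw [hσ', Complex.im_ofReal_mul]; exact mul_ne_zero (Real.exp_pos _).ne' hσ
  have hconj : conj σ' = (Real.exp (-(2 * s)) : ℝ) * conj σ := by
    rw [hσ', map_mul, Complex.conj_ofReal]
  have hd : ∀ x, ‖⟪δ - γ, x⟫_ℂ‖ ≤ M * |s| * ‖G x‖ := fun x => by
    rw [inner_sub_left, hδ, ContinuousLinearMap.adjoint_inner_left]; exact hγ x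
  have h1 : (Real.exp (2 * s) : ℂ) * ⟪γ, formRes J σ γ⟫_ℂ = ⟪δ, formRes J σ' δ⟫_ℂ := by
    rw [← hD.formRes_eq hV hσ, inner_smul_right, hδ, ContinuousLinearMap.adjoint_inner_left,
      hD.apply_neg]
  have h2 : ‖G (formRes J (conj σ') δ)‖ = Real.exp s * ‖G (formRes J σ γ)‖ := by
    rw [hconj, hδ, ← hD.formRes_eq hV (by simpa using hσ), map_smul, norm_smul, hD.norm_apply,
      norm_formRes_conj hV hσ, Complex.norm_real, Real.norm_of_nonneg (Real.exp_pos _).le,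
      ← mul_assoc, ← Real.exp_add]
    congr 2; ring
  have h3 : ⟪γ, formRes J σ' γ⟫_ℂ - ⟪δ, formRes J σ' δ⟫_ℂ =
      - (⟪δ - γ, formRes J σ' γ⟫_ℂ + ⟪formRes J (conj σ') δ, δ - γ⟫_ℂ) := by
    rw [← inner_formRes_conj hV hσ'0, map_sub, inner_sub_left, inner_sub_right]; ring
  rw [h1, h3, norm_neg, mul_add, ← h2]
  refine (norm_add_le _ _).trans (add_le_add (hd _) ?_)
  rw [← inner_conj_symm, RCLike.norm_conj]
  exact hd _

theorem IsDilation.norm_deriv_le {J : V →L[ℂ] H} {G : V →L[ℂ] E} {D : ℝ → V →L[ℂ] V}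
    (hV : ∀ u v : V, ⟪u, v⟫_ℂ = ⟪J u, J v⟫_ℂ + ⟪G u, G v⟫_ℂ) (hD : IsDilation J G D)
    {σ : ℂ} (hσ : σ.im ≠ 0) {γ : V} {M : ℝ}
    (hγ : ∀ s v, |s| ≤ 1 → ‖⟪γ, D s v⟫_ℂ - ⟪γ, v⟫_ℂ‖ ≤ M * |s| * ‖G v‖) :
    ‖deriv (fun σ => σ * ⟪γ, formRes J σ γ⟫_ℂ) σ‖ ≤ M * ‖G (formRes J σ γ)‖ := by
  set P : ℂ → ℂ := fun σ => σ * ⟪γ, formRes J σ γ⟫_ℂ with hP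
  let c : ℝ → ℂ := fun s => (Real.exp (-(2 * s)) : ℝ) * σ
  have hσ0 : 0 < ‖σ‖ := norm_pos_iff.2 fun h => hσ (by simp [h])
  have hc0 : c 0 = σ := by simp [c]
  have hc : HasDerivAt c (-2 * σ) 0 := by
    have : HasDerivAt (fun s : ℝ => Real.exp (-(2 * s))) (-2) 0 := by
      have := ((hasDerivAt_id (0 : ℝ)).const_mul 2).neg.exp
      simpa using this
    exact (this.ofReal_comp.mul_const σ).congr_deriv (by push_cast; rfl)
  have hPd : HasDerivAt P (deriv P σ) (c 0) := by
    rw [hc0]; exact (differentiableAt_mul_inner_formRes J hσ γ).hasDerivAt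
  have hcomp : HasDerivAt (P ∘ c) (deriv P σ * (-2 * σ)) 0 := hPd.comp 0 hc
  have hslope := hcomp.tendsto_slope_zero.norm
  have hcont : ContinuousAt (fun s => ‖G (formRes J (c s) γ)‖) 0 := by
    have h1 : ContinuousAt (fun s => formRes J (c s)) 0 := by
      refine ContinuousAt.comp (g := formRes J) ?_ hc.continuousAt
      rw [hc0]; exact (differentiableAt_formRes J hσ).continuousAt
    fun_prop
  have hlim : Filter.Tendsto (fun s : ℝ => ‖c s‖ * (M * (‖G (formRes J (c s) γ)‖
      + Real.exp s * ‖G (formRes J σ γ)‖))) (nhdsWithin 0 {0}ᶜ)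
      (nhds (‖c 0‖ * (M * (‖G (formRes J (c 0) γ)‖ + Real.exp 0 * ‖G (formRes J σ γ)‖)))) := by
    apply Filter.Tendsto.mono_left _ nhdsWithin_le_nhds
    have := hc.continuousAt
    apply ContinuousAt.tendsto
    fun_prop
  have hle := le_of_tendsto_of_tendsto hslope hlim (by
    have : ∀ᶠ s : ℝ in nhdsWithin 0 {0}ᶜ, |s| ≤ 1 :=
      nhdsWithin_le_nhds (by
        filter_upwards [Metric.closedBall_mem_nhds (0 : ℝ) one_pos] with s hs
        simpa using hs)
    filter_upwards [this, self_mem_nhdsWithin] with s hs hs0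
    have hs0' : 0 < |s| := abs_pos.2 hs0
    have key := hD.norm_sub_le hV hσ (s := s) (fun v => hγ s v hs)
    have he : P (c s) - P σ = c s * (⟪γ, formRes J (c s) γ⟫_ℂ
        - (Real.exp (2 * s) : ℂ) * ⟪γ, formRes J σ γ⟫_ℂ) := by
      have : (Real.exp (-(2 * s)) : ℝ) * (Real.exp (2 * s) : ℂ) = 1 := by
        rw [← Complex.ofReal_mul, ← Real.exp_add]; simp
      simp only [hP, c]
      linear_combination (σ * ⟪γ, formRes J σ γ⟫_ℂ) * this
    simp only [Function.comp, zero_add, hc0]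
    rw [norm_smul, he, norm_mul, norm_inv, Real.norm_eq_abs, inv_mul_le_iff₀ hs0']
    calc _ ≤ ‖c s‖ * _ := mul_le_mul_of_nonneg_left key (norm_nonneg _)
      _ = _ := by ring)
  rw [hc0, Real.exp_zero, norm_mul, norm_mul, norm_neg, Complex.norm_ofNat] at hle
  have : ‖deriv P σ‖ * (2 * ‖σ‖) ≤ (M * ‖G (formRes J σ γ)‖) * (2 * ‖σ‖) := by linarith
  exact le_of_mul_le_mul_right this (by positivity)

/-- Uniform bound for the quadratic form of the resolvent along a dilation group. -/
theorem IsDilation.norm_inner_formRes_self_le {J : V →L[ℂ] H} {G : V →L[ℂ] E} {D : ℝ → V →L[ℂ] V}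
    (hV : ∀ u v : V, ⟪u, v⟫_ℂ = ⟪J u, J v⟫_ℂ + ⟪G u, G v⟫_ℂ) (hD : IsDilation J G D)
    {σ : ℂ} (hσ : 0 < σ.im) {γ : V} {M : ℝ} (hM : 0 ≤ M) (hγ₀ : ∀ v, ‖⟪γ, v⟫_ℂ‖ ≤ M * ‖G v‖)
    (hγ : ∀ s v, |s| ≤ 1 → ‖⟪γ, D s v⟫_ℂ - ⟪γ, v⟫_ℂ‖ ≤ M * |s| * ‖G v‖) :
    ‖⟪γ, formRes J σ γ⟫_ℂ‖ ≤ 16 * M ^ 2 := by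
  set P : ℂ → ℂ := fun σ => σ * ⟪γ, formRes J σ γ⟫_ℂ with hP
  have hσ0 : 0 < ‖σ‖ := norm_pos_iff.2 fun h => hσ.ne' (by simp [h])
  set a := Real.sqrt σ.im
  set b := Real.sqrt (σ.im + ‖σ‖)
  set r := Real.sqrt ‖σ‖
  have ha : 0 < a := Real.sqrt_pos.2 hσ
  have hr : 0 < r := Real.sqrt_pos.2 hσ0
  have ha2 : a ^ 2 = σ.im := Real.sq_sqrt hσ.le
  have hr2 : r ^ 2 = ‖σ‖ := Real.sq_sqrt hσ0.le
  have hb2 : b ^ 2 = σ.im + ‖σ‖ := Real.sq_sqrt (by positivity)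
  have him : σ.im ≤ ‖σ‖ := (le_abs_self _).trans (Complex.abs_im_le_norm _)
  have hab : a ≤ b := Real.sqrt_le_sqrt (by linarith)
  have hba : b - a ≤ 3 / 2 * r := by
    have h1 : b ≤ 3 / 2 * r := abs_le_of_sq_le_sq' (by nlinarith) (by positivity) |>.2
    linarith
  let c : ℝ → ℂ := fun x => σ.re + (x ^ 2 : ℝ) * Complex.I
  have hcim : ∀ x, (c x).im = x ^ 2 := fun x => by
    simp only [c, Complex.add_im, Complex.ofReal_im, Complex.im_ofReal_mul, Complex.I_im]; ring
  have hca : c a = σ := by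
    simp only [c, ha2]; exact Complex.re_add_im σ
  have hpos : ∀ x ∈ Set.Icc a b, 0 < x := fun x hx => ha.trans_le hx.1
  have hcpos : ∀ x ∈ Set.Icc a b, 0 < (c x).im := fun x hx => by
    rw [hcim]; exact pow_pos (hpos x hx) 2
  have hderiv : ∀ x ∈ Set.Icc a b,
      HasDerivAt (P ∘ c) (deriv P (c x) * ((2 * x : ℝ) * Complex.I)) x := fun x hx => by
    have h1 : HasDerivAt c ((2 * x : ℝ) * Complex.I) x := by
      have h0 : HasDerivAt (fun x : ℝ => x ^ 2) (2 * x) x := by simpa using hasDerivAt_pow 2 x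
      exact (h0.ofReal_comp.mul_const Complex.I).const_add _
    exact (differentiableAt_mul_inner_formRes J (hcpos x hx).ne' γ).hasDerivAt.comp x h1
  obtain ⟨x₀, hx₀, hmax⟩ := isCompact_Icc.exists_isMaxOn (Set.nonempty_Icc.2 hab)
    (f := fun x => ‖(P ∘ c) x‖)
    (fun x hx => (hderiv x hx).continuousAt.continuousWithinAt.norm)
  set K := Real.sqrt ‖P (c x₀)‖
  have hK2 : K ^ 2 = ‖P (c x₀)‖ := Real.sq_sqrt (norm_nonneg _)
  have hK : 0 ≤ K := Real.sqrt_nonneg _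
  have hbd : ∀ x ∈ Set.Icc a b, ‖deriv P (c x) * ((2 * x : ℝ) * Complex.I)‖ ≤ 2 * M * K :=
    fun x hx => by
      have h1 := hD.norm_deriv_le hV (hcpos x hx).ne' hγ
      have h2 := norm_formRes_sq_le hV (hcpos x hx) γ
      have h3 : ‖P (c x)‖ ≤ K ^ 2 := by rw [hK2]; exact hmax hx
      have hx0 := hpos x hx
      have h4 : ‖G (formRes J (c x) γ)‖ ≤ K / x := by
        refine abs_le_of_sq_le_sq' (h2.trans ?_) (by positivity) |>.2
        rw [hcim, div_pow]
        gcongr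
      rw [norm_mul, norm_mul, Complex.norm_I, mul_one, Complex.norm_real,
        Real.norm_of_nonneg (by positivity)]
      calc _ ≤ (M * (K / x)) * (2 * x) := by
            gcongr; exact h1.trans (by gcongr)
        _ = _ := by field_simp
  have hmv := (convex_Icc a b).norm_image_sub_le_of_norm_hasDerivWithin_le
    (fun x hx => (hderiv x hx).hasDerivWithinAt) hbd (Set.right_mem_Icc.2 hab) hx₀
  have hPb : ‖P (c b)‖ ≤ 4 * M ^ 2 * r ^ 2 := by
    have hbm := Set.right_mem_Icc.2 hab
    refine (norm_mul_inner_formRes_le hV (hcpos b hbm) hγ₀).trans ?_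
    have h1 : ‖c b‖ ≤ 2 * r ^ 2 := by
      have : c b = σ + (‖σ‖ : ℝ) * Complex.I := by
        simp only [c, hb2]
        push_cast
        linear_combination Complex.re_add_im σ
      rw [this, hr2]
      refine (norm_add_le _ _).trans ?_
      rw [norm_mul, Complex.norm_I, mul_one, Complex.norm_real, norm_norm]
      linarith
    rw [hcim, hb2, div_le_iff₀ (by positivity)]
    calc M ^ 2 * ‖c b‖ ^ 2 ≤ M ^ 2 * (2 * r ^ 2) ^ 2 := by gcongr
      _ = 4 * M ^ 2 * r ^ 2 * ‖σ‖ := by rw [← hr2]; ring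
      _ ≤ _ := by gcongr; linarith
  have hdist : ‖x₀ - b‖ ≤ 3 / 2 * r := by
    rw [Real.norm_eq_abs, abs_le]; constructor <;> linarith [hx₀.1, hx₀.2]
  have hKle : K ≤ 4 * (M * r) := by
    have h1 : K ^ 2 ≤ 4 * M ^ 2 * r ^ 2 + 2 * M * K * (3 / 2 * r) := by
      have h2 : ‖P (c x₀)‖ ≤ ‖P (c b)‖ + ‖P (c x₀) - P (c b)‖ := by
        have := norm_add_le (P (c b)) (P (c x₀) - P (c b))
        rwa [add_sub_cancel] at this
      rw [hK2]
      refine h2.trans (add_le_add hPb (hmv.trans ?_))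
      gcongr
    have hm : 0 ≤ M * r := by positivity
    by_contra! hlt
    nlinarith
  have hfin : ‖P σ‖ ≤ 16 * M ^ 2 * ‖σ‖ := by
    have h1 : ‖P (c a)‖ ≤ K ^ 2 := by rw [hK2]; exact hmax (Set.left_mem_Icc.2 hab)
    rw [hca] at h1
    calc _ ≤ K ^ 2 := h1
      _ ≤ (4 * (M * r)) ^ 2 := by gcongr
      _ = _ := by rw [← hr2]; ring
  rw [hP, norm_mul, mul_comm] at hfin
  exact le_of_mul_le_mul_right hfin hσ0

theorem IsDilation.norm_inner_formRes_le {J : V →L[ℂ] H} {G : V →L[ℂ] E} {D : ℝ → V →L[ℂ] V}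
    (hV : ∀ u v : V, ⟪u, v⟫_ℂ = ⟪J u, J v⟫_ℂ + ⟪G u, G v⟫_ℂ) (hD : IsDilation J G D)
    {σ : ℂ} (hσ : 0 < σ.im) {γ₁ γ₂ : V} {M₁ M₂ : ℝ} (hM₁ : 0 ≤ M₁) (hM₂ : 0 ≤ M₂)
    (hγ₁₀ : ∀ v, ‖⟪γ₁, v⟫_ℂ‖ ≤ M₁ * ‖G v‖)
    (hγ₁ : ∀ s v, |s| ≤ 1 → ‖⟪γ₁, D s v⟫_ℂ - ⟪γ₁, v⟫_ℂ‖ ≤ M₁ * |s| * ‖G v‖)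
    (hγ₂₀ : ∀ v, ‖⟪γ₂, v⟫_ℂ‖ ≤ M₂ * ‖G v‖)
    (hγ₂ : ∀ s v, |s| ≤ 1 → ‖⟪γ₂, D s v⟫_ℂ - ⟪γ₂, v⟫_ℂ‖ ≤ M₂ * |s| * ‖G v‖) :
    ‖⟪γ₂, formRes J σ γ₁⟫_ℂ‖ ≤ 64 * (M₁ * M₂) := by
  have hzero : ∀ {γ : V} {M : ℝ}, M = 0 → (∀ v, ‖⟪γ, v⟫_ℂ‖ ≤ M * ‖G v‖) → γ = 0 := by
    intro γ M h0 h
    rw [← inner_self_eq_zero (𝕜 := ℂ), ← norm_le_zero_iff]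
    simpa [h0] using h γ
  rcases hM₁.eq_or_lt with h1 | h1
  · rw [hzero h1.symm hγ₁₀, map_zero, inner_zero_right, norm_zero]; positivity
  rcases hM₂.eq_or_lt with h2 | h2
  · rw [hzero h2.symm hγ₂₀, inner_zero_left, norm_zero]; positivity
  set M := M₁ * M₂ with hM
  have hM0 : 0 < M := mul_pos h1 h2
  have key : ∀ c : ℂ, ‖c‖ = 1 →
      ‖⟪formRes J σ ((M₁ : ℂ) • γ₂ + c • (M₂ : ℂ) • γ₁),
        (M₁ : ℂ) • γ₂ + c • (M₂ : ℂ) • γ₁⟫_ℂ‖ ≤ 64 * M ^ 2 := by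
    intro c hc
    rw [← inner_conj_symm, RCLike.norm_conj]
    have hn : ∀ x : ℝ, 0 ≤ x → ∀ z : ℂ, ‖(x : ℂ) * z‖ = x * ‖z‖ := fun x hx z => by
      rw [norm_mul, Complex.norm_real, Real.norm_of_nonneg hx]
    refine (hD.norm_inner_formRes_self_le hV hσ (M := 2 * M) (by positivity)
      (fun v => ?_) fun s v hs => ?_).trans (by ring_nf; rfl)
    · simp only [inner_add_left, inner_smul_left, Complex.conj_ofReal]
      refine (norm_add_le _ _).trans ?_
      rw [norm_mul (conj c), RCLike.norm_conj, hc, one_mul, hn _ hM₁, hn _ hM₂]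
      have e1 := mul_le_mul_of_nonneg_left (hγ₁₀ v) hM₂
      have e2 := mul_le_mul_of_nonneg_left (hγ₂₀ v) hM₁
      rw [hM]; linarith
    · simp only [inner_add_left, inner_smul_left, Complex.conj_ofReal]
      rw [add_sub_add_comm, ← mul_sub, ← mul_sub, ← mul_sub]
      refine (norm_add_le _ _).trans ?_
      rw [norm_mul (conj c), RCLike.norm_conj, hc, one_mul, hn _ hM₁, hn _ hM₂]
      have e1 := mul_le_mul_of_nonneg_left (hγ₁ s v hs) hM₂
      have e2 := mul_le_mul_of_nonneg_left (hγ₂ s v hs) hM₁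
      rw [hM]; linarith
  have hpol := inner_map_polarization (formRes J σ).toLinearMap ((M₁ : ℂ) • γ₂) ((M₂ : ℂ) • γ₁)
  simp only [ContinuousLinearMap.coe_coe] at hpol
  have k1 := key 1 (by simp)
  have k2 := key (-1) (by simp)
  have k3 := key Complex.I (by simp)
  have k4 := key (-Complex.I) (by simp)
  simp only [one_smul, neg_smul, ← sub_eq_add_neg] at k1 k2 k3 k4
  have hb : ‖⟪formRes J σ ((M₂ : ℂ) • γ₁), (M₁ : ℂ) • γ₂⟫_ℂ‖ ≤ 64 * M ^ 2 := by
    rw [hpol, norm_div, Complex.norm_ofNat, div_le_iff₀ (by norm_num)]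
    refine (_root_.norm_sub_le _ _).trans ?_
    rw [norm_mul, Complex.norm_I, one_mul]
    have e1 := norm_add_le (⟪formRes J σ ((M₁ : ℂ) • γ₂ + (M₂ : ℂ) • γ₁),
      (M₁ : ℂ) • γ₂ + (M₂ : ℂ) • γ₁⟫_ℂ - ⟪formRes J σ ((M₁ : ℂ) • γ₂ - (M₂ : ℂ) • γ₁),
      (M₁ : ℂ) • γ₂ - (M₂ : ℂ) • γ₁⟫_ℂ) (Complex.I * ⟪formRes J σ ((M₁ : ℂ) • γ₂ +
        Complex.I • (M₂ : ℂ) • γ₁), (M₁ : ℂ) • γ₂ + Complex.I • (M₂ : ℂ) • γ₁⟫_ℂ)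
    have e2 := _root_.norm_sub_le (⟪formRes J σ ((M₁ : ℂ) • γ₂ + (M₂ : ℂ) • γ₁),
      (M₁ : ℂ) • γ₂ + (M₂ : ℂ) • γ₁⟫_ℂ) (⟪formRes J σ ((M₁ : ℂ) • γ₂ - (M₂ : ℂ) • γ₁),
      (M₁ : ℂ) • γ₂ - (M₂ : ℂ) • γ₁⟫_ℂ)
    rw [norm_mul, Complex.norm_I, one_mul] at e1
    linarith
  rw [← inner_conj_symm, RCLike.norm_conj, map_smul, inner_smul_left, inner_smul_right, norm_mul,
    norm_mul, RCLike.norm_conj, Complex.norm_real, Complex.norm_real, Real.norm_of_nonneg hM₁,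
    Real.norm_of_nonneg hM₂, ← mul_assoc, ← hM] at hb
  have : M * ‖⟪γ₂, formRes J σ γ₁⟫_ℂ‖ ≤ M * (64 * M) := by linarith
  exact le_of_mul_le_mul_left this hM0

variable {S : Type*} [AddCommGroup S] [Module ℂ S]

theorem norm_apply_le_of_denseRange {J' : V →L[ℂ] H} {G' : V →L[ℂ] E}
    (hV : ∀ u v : V, ⟪u, v⟫_ℂ = ⟪J' u, J' v⟫_ℂ + ⟪G' u, G' v⟫_ℂ) {e : S →ₗ[ℂ] V}
    (hdense : DenseRange e) {J : S →ₗ[ℂ] H} {G : S →ₗ[ℂ] E} (hJ' : ∀ v, J' (e v) = J v)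
    (hG' : ∀ v, G' (e v) = G v) {D : ℝ → S →ₗ[ℂ] S}
    (hD : ∀ s v, D s (D (-s) v) = v)
    (hDJ : ∀ s u v, ⟪J (D s u), J (D s v)⟫_ℂ = ⟪J u, J v⟫_ℂ)
    (hDG : ∀ s u v, ⟪G (D s u), G (D s v)⟫_ℂ = (Real.exp (2 * s) : ℂ) * ⟪G u, G v⟫_ℂ)
    {σ : ℂ} (hσ : σ.im ≠ 0) (l₁ l₂ : S →ₗ[ℂ] ℂ) {M₁ M₂ : ℝ} (hM₁ : 0 ≤ M₁) (hM₂ : 0 ≤ M₂)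
    (hl₁₀ : ∀ v, ‖l₁ v‖ ≤ M₁ * ‖G v‖)
    (hl₁ : ∀ s v, |s| ≤ 1 → ‖l₁ (D s v) - l₁ v‖ ≤ M₁ * |s| * ‖G v‖)
    (hl₂₀ : ∀ v, ‖l₂ v‖ ≤ M₂ * ‖G v‖)
    (hl₂ : ∀ s v, |s| ≤ 1 → ‖l₂ (D s v) - l₂ v‖ ≤ M₂ * |s| * ‖G v‖)
    {f : S} (hf : ∀ v, ⟪G f, G v⟫_ℂ - conj σ * ⟪J f, J v⟫_ℂ = l₁ v) :
    ‖l₂ f‖ ≤ 64 * (M₁ * M₂) := by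
  have hnorm : ∀ v, ‖e v‖ ^ 2 = ‖J v‖ ^ 2 + ‖G v‖ ^ 2 := fun v =>
by
    have h := hV (e v) (e v)
    rw [inner_self_eq_norm_sq_to_K, inner_self_eq_norm_sq_to_K, inner_self_eq_norm_sq_to_K,
      hJ', hG'] at h
    exact_mod_cast h
  have hGe : ∀ v, ‖G v‖ ≤ ‖e v‖ := fun v => by
    have := hnorm v
    exact le_of_sq_le_sq (by nlinarith [sq_nonneg ‖J v‖]) (norm_nonneg _)
  have hJs : ∀ s v, ‖J (D s v)‖ = ‖J v‖ := fun s v => by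
    have h := hDJ s v v
    rw [inner_self_eq_norm_sq_to_K, inner_self_eq_norm_sq_to_K] at h
    exact (pow_left_inj₀ (norm_nonneg _) (norm_nonneg _) two_ne_zero).1 (by exact_mod_cast h)
  have hGs : ∀ s v, ‖G (D s v)‖ = Real.exp s * ‖G v‖ := fun s v => by
    have h := hDG s v v
    rw [inner_self_eq_norm_sq_to_K, inner_self_eq_norm_sq_to_K] at h
    have h' : ‖G (D s v)‖ ^ 2 = Real.exp (2 * s) * ‖G v‖ ^ 2 :=
      Complex.ofReal_injective (by push_cast at h ⊢; exact h)
    rw [two_mul, Real.exp_add, ← sq, ← mul_pow] at h'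
    exact (pow_left_inj₀ (norm_nonneg _) (by positivity) two_ne_zero).1 h'
  have hDe : ∀ s, ∃ C, ∀ v, ‖(e ∘ₗ D s) v‖ ≤ C * ‖e v‖ := fun s => by
    refine ⟨1 + Real.exp s, fun v => le_of_sq_le_sq ?_ (by positivity)⟩
    rw [LinearMap.comp_apply, hnorm, hJs, hGs, mul_pow, mul_pow, hnorm]
    nlinarith [Real.exp_pos s, sq_nonneg ‖J v‖, sq_nonneg ‖G v‖,
      mul_nonneg (Real.exp_pos s).le (sq_nonneg ‖J v‖), mul_nonneg (Real.exp_pos s).le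
      (sq_nonneg ‖G v‖), mul_nonneg (sq_nonneg (Real.exp s)) (sq_nonneg ‖J v‖)]
  let D' : ℝ → V →L[ℂ] V := fun s => (e ∘ₗ D s).extendOfNorm e
  have hD' : ∀ s v, D' s (e v) = e (D s v) := fun s v =>
    LinearMap.extendOfNorm_eq hdense (hDe s) v
  have hle : ∀ {l : S →ₗ[ℂ] ℂ} {M : ℝ}, 0 ≤ M → (∀ v, ‖l v‖ ≤ M * ‖G v‖) →
      ∃ C, ∀ v, ‖l v‖ ≤ C * ‖e v‖ := fun {l M} hM h =>
    ⟨M, fun v => (h v).trans (mul_le_mul_of_nonneg_left (hGe v) hM)⟩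
  have hriesz : ∀ {l : S →ₗ[ℂ] ℂ} {M : ℝ}, 0 ≤ M → (∀ v, ‖l v‖ ≤ M * ‖G v‖) →
      (∀ s v, |s| ≤ 1 → ‖l (D s v) - l v‖ ≤ M * |s| * ‖G v‖) → ∃ γ : V,
      (∀ v, ⟪γ, e v⟫_ℂ = l v) ∧ (∀ v, ‖⟪γ, v⟫_ℂ‖ ≤ M * ‖G' v‖) ∧
      (∀ s v, |s| ≤ 1 → ‖⟪γ, D' s v⟫_ℂ - ⟪γ, v⟫_ℂ‖ ≤ M * |s| * ‖G' v‖) := by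
    intro l M hM h0 h1
    refine ⟨(InnerProductSpace.toDual ℂ V).symm (l.extendOfNorm e), ?_, ?_, ?_⟩
    · intro v
      rw [InnerProductSpace.toDual_symm_apply]
      exact LinearMap.extendOfNorm_eq hdense (hle hM h0) v
    · intro v
      refine hdense.induction_on v (isClosed_le (by fun_prop) (by fun_prop)) fun v => ?_
      rw [InnerProductSpace.toDual_symm_apply, LinearMap.extendOfNorm_eq hdense (hle hM h0)]
      rw [hG']; exact h0 v
    · intro s v hs
      refine hdense.induction_on v (isClosed_le (by fun_prop) (by fun_prop)) fun v => ?_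
      rw [hD', InnerProductSpace.toDual_symm_apply, InnerProductSpace.toDual_symm_apply,
        LinearMap.extendOfNorm_eq hdense (hle hM h0), LinearMap.extendOfNorm_eq hdense (hle hM h0)]
      rw [hG']; exact h1 s v hs
  have hDil : IsDilation J' G' D' := by
    refine ⟨fun s v => ?_, fun s u v => ?_, fun s u v => ?_⟩
    · refine hdense.induction_on v (isClosed_eq (by fun_prop) (by fun_prop)) fun v => ?_
      rw [hD', hD', hD]
    · refine hdense.induction_on₂ (isClosed_eq (by fun_prop) (by fun_prop)) (fun u v => ?_) u v
      simp only [hD', hJ', hDJ]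
    · refine hdense.induction_on₂ (isClosed_eq (by fun_prop) (by fun_prop)) (fun u v => ?_) u v
      simp only [hD', hG', hDG]
  obtain ⟨γ₁, h10, h11, h12⟩ := hriesz hM₁ hl₁₀ hl₁
  obtain ⟨γ₂, h20, h21, h22⟩ := hriesz hM₂ hl₂₀ hl₂
  have hfR : e f = formRes J' σ γ₁ := by
    refine eq_formRes hV hσ fun w => ?_
    refine hdense.induction_on w (isClosed_eq (by fun_prop) (by fun_prop)) fun w => ?_
    rw [hJ', hJ', hG', hG', ← inner_conj_symm (e w), h10, ← hf]
    simp only [map_sub, map_mul, inner_conj_symm, Complex.conj_conj]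
  rw [← h20, hfR]
  rcases lt_or_gt_of_ne hσ with h | h
  · rw [inner_formRes_conj hV hσ, ← inner_conj_symm, RCLike.norm_conj, mul_comm M₁]
    exact hDil.norm_inner_formRes_le hV (by simpa using h) hM₂ hM₁ h21 h22 h11 h12
  · exact hDil.norm_inner_formRes_le hV h hM₁ hM₂ h11 h12 h21 h22

/-- Resolvent estimate for a form `⟪G ·, G ·⟫ - σ ⟪J ·, J ·⟫` on a complex vector space carrying a
group of dilations. -/
theorem norm_apply_le_of_dilation [CompleteSpace E] (J : S →ₗ[ℂ] H) (G : S →ₗ[ℂ] E)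
    (D : ℝ → S →ₗ[ℂ] S) (hD : ∀ s v, D s (D (-s) v) = v)
    (hDJ : ∀ s u v, ⟪J (D s u), J (D s v)⟫_ℂ = ⟪J u, J v⟫_ℂ)
    (hDG : ∀ s u v, ⟪G (D s u), G (D s v)⟫_ℂ = (Real.exp (2 * s) : ℂ) * ⟪G u, G v⟫_ℂ)
    {σ : ℂ} (hσ : σ.im ≠ 0) (l₁ l₂ : S →ₗ[ℂ] ℂ) {M₁ M₂ : ℝ} (hM₁ : 0 ≤ M₁) (hM₂ : 0 ≤ M₂)
    (hl₁₀ : ∀ v, ‖l₁ v‖ ≤ M₁ * ‖G v‖)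
    (hl₁ : ∀ s v, |s| ≤ 1 → ‖l₁ (D s v) - l₁ v‖ ≤ M₁ * |s| * ‖G v‖)
    (hl₂₀ : ∀ v, ‖l₂ v‖ ≤ M₂ * ‖G v‖)
    (hl₂ : ∀ s v, |s| ≤ 1 → ‖l₂ (D s v) - l₂ v‖ ≤ M₂ * |s| * ‖G v‖)
    {f : S} (hf : ∀ v, ⟪G f, G v⟫_ℂ - conj σ * ⟪J f, J v⟫_ℂ = l₁ v) :
    ‖l₂ f‖ ≤ 64 * (M₁ * M₂) := by
  let T : S →ₗ[ℂ] WithLp 2 (H × E) := (WithLp.linearEquiv 2 ℂ (H × E)).symm.toLinearMap ∘ₗ J.prod G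
  let V : Submodule ℂ (WithLp 2 (H × E)) := (LinearMap.range T).topologicalClosure
  let e : S →ₗ[ℂ] V := T.codRestrict V fun v => Submodule.le_topologicalClosure _ ⟨v, rfl⟩
  have : CompleteSpace V := (Submodule.isClosed_topologicalClosure _).completeSpace_coe
  let J' : V →L[ℂ] H := WithLp.fstL 2 ℂ H E ∘L V.subtypeL
  let G' : V →L[ℂ] E := WithLp.sndL 2 ℂ H E ∘L V.subtypeL
  have hJ' : ∀ v, J' (e v) = J v := fun v => rfl
  have hG' : ∀ v, G' (e v) = G v := fun v => rfl
  have hV : ∀ u v : V, ⟪u, v⟫_ℂ = ⟪J' u, J' v⟫_ℂ + ⟪G' u, G' v⟫_ℂ := fun u v => by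
    rw [Submodule.coe_inner, WithLp.prod_inner_apply]; rfl
  have hdense : DenseRange e := by
    rw [DenseRange, Subtype.dense_iff]
    intro x hx
    have hx' : x ∈ closure (Set.range T) := by
      rw [← LinearMap.coe_range, ← Submodule.topologicalClosure_coe]; exact hx
    rwa [← Set.range_comp]
  exact norm_apply_le_of_denseRange hV hdense hJ' hG' hD hDJ hDG hσ l₁ l₂ hM₁ hM₂
    hl₁₀ hl₁ hl₂₀ hl₂ hf

end Abstract

section Heisenberg

open scoped ComplexConjugate SchwartzMap InnerProductSpace

/-- The derivative of a Schwartz function along a vector field of temperate growth. -/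
def vectorField {E : Type*} [NormedAddCommGroup E] [NormedSpace ℝ E] {m : E → E}
    (hm : m.HasTemperateGrowth) : 𝓢(E, ℂ) →ₗ[ℂ] 𝓢(E, ℂ) where
  toFun f := SchwartzMap.bilinLeftCLM (ContinuousLinearMap.id ℝ (E →L[ℝ] ℂ)) hm
    (SchwartzMap.fderivCLM ℝ E ℂ f)
  map_add' f g := by simp
  map_smul' c f := by
    ext p
    change fderiv ℝ (c • (f : E → ℂ)) p (m p) = c • fderiv ℝ f p (m p)
    rw [fderiv_const_smul f.differentiableAt]
    rfl

theorem ContinuousLinearMap.hasTemperateGrowth_const_add {E F : Type*} [NormedAddCommGroup E]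
    [NormedSpace ℝ E] [NormedAddCommGroup F] [NormedSpace ℝ F] (v : F) (m : E →L[ℝ] F) :
    (fun p => v + m p).HasTemperateGrowth :=
  (Function.HasTemperateGrowth.const v).add m.hasTemperateGrowth

/-- The pointwise product `conj f * g` of Schwartz functions. -/
def SchwartzMap.conjMul {E : Type*} [NormedAddCommGroup E] [NormedSpace ℝ E] (f g : 𝓢(E, ℂ)) :
    𝓢(E, ℂ) :=
  SchwartzMap.bilinLeftCLM (((ContinuousLinearMap.mul ℝ ℂ).comp
    (Complex.conjCLE : ℂ →L[ℝ] ℂ)).flip) f.hasTemperateGrowth g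

theorem SchwartzMap.conjMul_apply {E : Type*} [NormedAddCommGroup E] [NormedSpace ℝ E]
    (f g : 𝓢(E, ℂ)) (p : E) : f.conjMul g p = conj (f p) * g p := rfl

theorem SchwartzMap.fderiv_conjMul {E : Type*} [NormedAddCommGroup E] [NormedSpace ℝ E]
    (f g : 𝓢(E, ℂ)) (p v : E) :
    fderiv ℝ (f.conjMul g) p v = conj (fderiv ℝ f p v) * g p + conj (f p) * fderiv ℝ g p v := by
  have h1 : HasFDerivAt (fun q => conj (f q))
      ((Complex.conjCLE : ℂ →L[ℝ] ℂ).comp (fderiv ℝ f p)) p :=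
    Complex.conjCLE.hasFDerivAt.comp p f.differentiableAt.hasFDerivAt
  have h2 := (h1.mul g.differentiableAt.hasFDerivAt).fderiv
  have h3 : (fun q => conj (f q)) * (g : E → ℂ) = f.conjMul g := rfl
  rw [h3] at h2
  rw [h2]
  simp [mul_comm, add_comm]

/-- Fields of the form `v + ℓ(p) w` with `ℓ w = 0` are divergence free. -/
theorem integral_vectorField_eq_zero {E : Type*} [NormedAddCommGroup E] [NormedSpace ℝ E]
    [FiniteDimensional ℝ E] [MeasurableSpace E] [BorelSpace E] {μ : Measure E} [μ.IsAddHaarMeasure]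
    [μ.HasTemperateGrowth]
    (v w : E) (l : E →L[ℝ] ℝ) (hl : l w = 0)
    {m : E → E} (hm : ∀ p, m p = v + l p • w) (f : 𝓢(E, ℂ)) :
    ∫ p, fderiv ℝ f p (m p) ∂μ = 0 := by
  have hv : Integrable (fun p => fderiv ℝ f p v) μ :=
    (vectorField (Function.HasTemperateGrowth.const v) f).integrable
  have hw : Integrable (fun p => fderiv ℝ f p (l p • w)) μ :=
    (vectorField (m := fun p => l p • w)
      (((ContinuousLinearMap.id ℝ ℝ).smulRight w ∘L l).hasTemperateGrowth) f).integrable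
  have hlf : Integrable (fun p => (l p : ℂ) * f p) μ := by
    have := (SchwartzMap.bilinLeftCLM (ContinuousLinearMap.lsmul ℝ ℝ (E := ℂ)).flip
      l.hasTemperateGrowth f).integrable (μ := μ)
    exact this
  have e1 : ∫ p, fderiv ℝ f p v ∂μ = 0 := by
    have := integral_mul_fderiv_eq_neg_fderiv_mul_of_integrable (μ := μ) (f := fun _ => (1 : ℂ))
      (g := f) (v := v) (by simp) (by simpa using hv) (by simpa using f.integrable)
      (fun _ _ => by fun_prop) (fun _ _ => f.differentiableAt)
    simpa using this
  have e2 : ∫ p, fderiv ℝ f p (l p • w) ∂μ = 0 := by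
    have hd : ∀ p, HasFDerivAt (fun p => (l p : ℂ)) (Complex.ofRealCLM.comp l) p := fun p =>
      Complex.ofRealCLM.hasFDerivAt.comp p l.hasFDerivAt
    have := integral_mul_fderiv_eq_neg_fderiv_mul_of_integrable (μ := μ) (f := fun p => (l p : ℂ))
      (g := f) (v := w) (by simp [(hd _).fderiv, hl]) (by simpa using hw) hlf
      (fun _ _ => (hd _).differentiableAt) (fun _ _ => f.differentiableAt)
    simpa [(hd _).fderiv, hl] using this
  simp only [hm, map_add]
  rw [integral_add hv hw, e1, e2, add_zero]

/-- Integration by parts along a divergence free field. -/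
theorem integral_conj_mul_vectorField {E : Type*} [NormedAddCommGroup E] [NormedSpace ℝ E]
    [FiniteDimensional ℝ E] [MeasurableSpace E] [BorelSpace E] {μ : Measure E} [μ.IsAddHaarMeasure]
    [μ.HasTemperateGrowth]
    {m : E → E} (hm : m.HasTemperateGrowth) (v w : E) (l : E →L[ℝ] ℝ) (hl : l w = 0)
    (hml : ∀ p, m p = v + l p • w) (f g : 𝓢(E, ℂ)) :
    ∫ p, conj (f p) * vectorField hm g p ∂μ = - ∫ p, conj (vectorField hm f p) * g p ∂μ := by
  have h := integral_vectorField_eq_zero (μ := μ) v w l hl hml (f.conjMul g)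
  simp only [SchwartzMap.fderiv_conjMul] at h
  have h' := integral_add ((vectorField hm f).conjMul g).integrable
    (f.conjMul (vectorField hm g)).integrable (μ := μ)
  rw [add_comm] at h'
  exact eq_neg_of_add_eq_zero_left (h'.symm.trans h)

/-- The constant part of the horizontal fields `X_j`, `Y_j`. -/
def horizVec (d : ℕ) : Fin d ⊕ Fin d → Hd d
  | .inl j => (EuclideanSpace.single j 1, 0, 0)
  | .inr j => (0, EuclideanSpace.single j 1, 0)

/-- The `∂_t` coefficient of the horizontal fields `X_j`, `Y_j`. -/
def horizCoeff (d : ℕ) : Fin d ⊕ Fin d → Hd d →L[ℝ] ℝ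
  | .inl j => (2 : ℝ) • (EuclideanSpace.proj j ∘L ContinuousLinearMap.fst ℝ _ ℝ ∘L
      ContinuousLinearMap.snd ℝ _ _)
  | .inr j => (-2 : ℝ) • (EuclideanSpace.proj j ∘L ContinuousLinearMap.fst ℝ _ _)

/-- The horizontal fields as vector-valued functions. -/
def horizField (d : ℕ) (i : Fin d ⊕ Fin d) (p : Hd d) : Hd d :=
  horizVec d i + horizCoeff d i p • (0, 0, 1)

theorem hasTemperateGrowth_horizField (d : ℕ) (i : Fin d ⊕ Fin d) :
    (horizField d i).HasTemperateGrowth :=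
  ContinuousLinearMap.hasTemperateGrowth_const_add (horizVec d i)
    ((ContinuousLinearMap.id ℝ ℝ).smulRight (0, 0, 1) ∘L horizCoeff d i)

/-- The horizontal fields acting on Schwartz functions. -/
def horiz (d : ℕ) (i : Fin d ⊕ Fin d) : 𝓢(Hd d, ℂ) →ₗ[ℂ] 𝓢(Hd d, ℂ) :=
  vectorField (hasTemperateGrowth_horizField d i)

theorem horiz_apply (d : ℕ) (i : Fin d ⊕ Fin d) (f : 𝓢(Hd d, ℂ)) (p : Hd d) :
    horiz d i f p = fderiv ℝ f p (horizField d i p) := rfl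

theorem horiz_inl (d : ℕ) (j : Fin d) (f : 𝓢(Hd d, ℂ)) :
    ⇑(horiz d (.inl j) f) = Xop d j f := by
  ext p
  simp [horiz_apply, Xop, horizField, horizVec, horizCoeff]

theorem horiz_inr (d : ℕ) (j : Fin d) (f : 𝓢(Hd d, ℂ)) :
    ⇑(horiz d (.inr j) f) = Yop d j f := by
  ext p
  simp [horiz_apply, Yop, horizField, horizVec, horizCoeff]

theorem gradHsq_eq (d : ℕ) (f : 𝓢(Hd d, ℂ)) (p : Hd d) :
    gradHsq d f p = ∑ i, ‖horiz d i f p‖ ^ 2 := by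
  simp [gradHsq, Fintype.sum_sum_type, horiz_inl, horiz_inr, Finset.sum_add_distrib]

theorem subLap_eq (d : ℕ) (f : 𝓢(Hd d, ℂ)) (p : Hd d) :
    subLap d f p = ∑ i, horiz d i (horiz d i f) p := by
  simp [subLap, Fintype.sum_sum_type, horiz_inl, horiz_inr, Finset.sum_add_distrib]

instance isAddHaarMeasure_volume_heisenberg (d : ℕ) :
    (volume : Measure (Hd d)).IsAddHaarMeasure :=
  have : (volume : Measure (EuclideanSpace ℝ (Fin d) × ℝ)).IsAddHaarMeasure :=
    MeasureTheory.Measure.prod.instIsAddHaarMeasure _ _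
  MeasureTheory.Measure.prod.instIsAddHaarMeasure _ _

theorem integral_conj_mul_horiz (d : ℕ) (i : Fin d ⊕ Fin d) (f g : 𝓢(Hd d, ℂ)) :
    ∫ p, conj (f p) * horiz d i g p = - ∫ p, conj (horiz d i f p) * g p :=
  integral_conj_mul_vectorField _ (horizVec d i) (0, 0, 1) (horizCoeff d i)
    (by cases i <;> simp [horizCoeff]) (fun _ => rfl) f g

/-- The generator `(x, y, 2t)` of the dilations. -/
def eulerCLM (d : ℕ) : Hd d →L[ℝ] Hd d :=
  (ContinuousLinearMap.id ℝ _).prodMap ((ContinuousLinearMap.id ℝ _).prodMap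
    ((2 : ℝ) • ContinuousLinearMap.id ℝ ℝ))

/-- The generator of the dilations acting on Schwartz functions. -/
def euler (d : ℕ) : 𝓢(Hd d, ℂ) →ₗ[ℂ] 𝓢(Hd d, ℂ) :=
  vectorField (eulerCLM d).hasTemperateGrowth

theorem euler_apply (d : ℕ) (f : 𝓢(Hd d, ℂ)) (p : Hd d) :
    euler d f p = fderiv ℝ f p (eulerCLM d p) := rfl

theorem zsq_nonneg (d : ℕ) (p : Hd d) : 0 ≤ zsq d p := by unfold zsq; positivity

theorem zn_sq (d : ℕ) (p : Hd d) : zn d p ^ 2 = zsq d p := Real.sq_sqrt (zsq_nonneg d p)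

theorem w4_sq (d : ℕ) (p : Hd d) : w4 d p ^ 2 = zsq d p / (zsq d p ^ 2 + p.2.2 ^ 2) := by
  have h : zn d p ^ 4 = zsq d p ^ 2 := by rw [← zn_sq]; ring
  rw [w4, div_pow, zn_sq, Real.sq_sqrt (by rw [h]; positivity), h]

theorem zsq_eq_sum (d : ℕ) (p : Hd d) : zsq d p = ∑ j, (p.1 j ^ 2 + p.2.1 j ^ 2) := by
  simp [zsq, EuclideanSpace.norm_sq_eq, Finset.sum_add_distrib]

/-- Coefficients expressing `|z|²` times the dilation generator through horizontal fields. -/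
def eulerCoeff (d : ℕ) (p : Hd d) : Fin d ⊕ Fin d → ℝ
  | .inl j => zsq d p * p.1 j + p.2.2 * p.2.1 j
  | .inr j => zsq d p * p.2.1 j - p.2.2 * p.1 j

theorem sum_eulerCoeff_sq (d : ℕ) (p : Hd d) :
    ∑ i, eulerCoeff d p i ^ 2 = zsq d p * (zsq d p ^ 2 + p.2.2 ^ 2) := by
  rw [Fintype.sum_sum_type, ← Finset.sum_add_distrib]
  have h : ∀ c, zsq d p * c = ∑ j, (p.1 j ^ 2 + p.2.1 j ^ 2) * c := fun c => by
    rw [zsq_eq_sum, Finset.sum_mul]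
  rw [h]
  refine Finset.sum_congr rfl fun j _ => ?_
  simp only [eulerCoeff]
  ring

theorem zsq_smul_eulerCLM (d : ℕ) (p : Hd d) :
    zsq d p • eulerCLM d p =
      ∑ i, eulerCoeff d p i • horizField d i p - p.2.2 • (p.2.1, -p.1, 0) := by
  obtain ⟨x, y, t⟩ := p
  rw [Fintype.sum_sum_type]
  refine Prod.ext ?_ (Prod.ext ?_ ?_)
  · ext k
    simp [eulerCLM, horizField, horizVec, eulerCoeff, Prod.fst_sum, Finset.sum_apply,
      Pi.single_apply]
  · ext k
    simp [eulerCLM, horizField, horizVec, eulerCoeff, Prod.fst_sum, Prod.snd_sum, Finset.sum_apply,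
      Pi.single_apply]
  · simp only [eulerCLM, horizField, horizVec, eulerCoeff, horizCoeff]
    simp only [Prod.snd_sub, Prod.snd_add, Prod.snd_sum]
    simp
    rw [← Finset.sum_neg_distrib, ← Finset.sum_add_distrib, zsq_eq_sum, Finset.sum_mul]
    refine Finset.sum_congr rfl fun j _ => ?_
    ring

theorem w4_sq_mul_norm_euler_le {d : ℕ} {f : 𝓢(Hd d, ℂ)} {p : Hd d} (hf : Nop d f p = 0) :
    w4 d p ^ 2 * ‖euler d f p‖ ^ 2 ≤ gradHsq d f p := by
  have h1 : (zsq d p : ℂ) * euler d f p = ∑ i, (eulerCoeff d p i : ℂ) * horiz d i f p := by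
    have := congrArg (fderiv ℝ f p) (zsq_smul_eulerCLM d p)
    rw [map_sub, map_smul, map_smul, map_sum] at this
    rw [Nop] at hf
    rw [hf, smul_zero, sub_zero] at this
    simp only [map_smul, Complex.real_smul] at this
    exact this
  have h2 : zsq d p ^ 2 * ‖euler d f p‖ ^ 2 ≤
      zsq d p * (zsq d p ^ 2 + p.2.2 ^ 2) * gradHsq d f p := by
    calc zsq d p ^ 2 * ‖euler d f p‖ ^ 2 = ‖(zsq d p : ℂ) * euler d f p‖ ^ 2 := by
          rw [norm_mul, Complex.norm_real, mul_pow, Real.norm_eq_abs, sq_abs]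
      _ ≤ (∑ i, |eulerCoeff d p i| * ‖horiz d i f p‖) ^ 2 := by
          rw [h1]
          gcongr
          refine (norm_sum_le _ _).trans_eq ?_
          simp [Complex.norm_real]
      _ ≤ (∑ i, |eulerCoeff d p i| ^ 2) * ∑ i, ‖horiz d i f p‖ ^ 2 :=
          Finset.sum_mul_sq_le_sq_mul_sq _ _ _
      _ = _ := by simp only [sq_abs, sum_eulerCoeff_sq, gradHsq_eq]
  have hg : 0 ≤ gradHsq d f p := by rw [gradHsq_eq]; positivity
  rw [w4_sq]
  rcases (zsq_nonneg d p).eq_or_lt with h | h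
  · rw [← h]; simpa using hg
  · rw [div_mul_eq_mul_div, div_le_iff₀ (by positivity)]
    refine le_of_mul_le_mul_left ?_ h
    linarith

/-- The linear map underlying the dilations. -/
def dilLin (d : ℕ) (s : ℝ) : Hd d →L[ℝ] Hd d :=
  (Real.exp s • ContinuousLinearMap.id ℝ _).prodMap
    ((Real.exp s • ContinuousLinearMap.id ℝ _).prodMap
      (Real.exp (2 * s) • ContinuousLinearMap.id ℝ ℝ))

theorem dilLin_apply (d : ℕ) (s : ℝ) (p : Hd d) :
    dilLin d s p = (Real.exp s • p.1, Real.exp s • p.2.1, Real.exp (2 * s) * p.2.2) := rfl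

theorem dilLin_dilLin (d : ℕ) (s r : ℝ) (p : Hd d) :
    dilLin d s (dilLin d r p) = dilLin d (s + r) p := by
  simp [dilLin_apply, smul_smul, Real.exp_add, mul_add, mul_assoc]

theorem dilLin_zero (d : ℕ) (p : Hd d) : dilLin d 0 p = p := by simp [dilLin_apply]

/-- The dilation `(x, y, t) ↦ (e^s x, e^s y, e^{2s} t)`. -/
def dil (d : ℕ) (s : ℝ) : Hd d ≃L[ℝ] Hd d :=
  ContinuousLinearEquiv.equivOfInverse (dilLin d s) (dilLin d (-s))
    (fun p => by rw [dilLin_dilLin, neg_add_cancel, dilLin_zero])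
    (fun p => by rw [dilLin_dilLin, add_neg_cancel, dilLin_zero])

theorem dil_apply (d : ℕ) (s : ℝ) (p : Hd d) :
    dil d s p = (Real.exp s • p.1, Real.exp s • p.2.1, Real.exp (2 * s) * p.2.2) := rfl

theorem dil_dil (d : ℕ) (s r : ℝ) (p : Hd d) : dil d s (dil d r p) = dil d (s + r) p :=
  dilLin_dilLin d s r p

theorem dil_zero (d : ℕ) (p : Hd d) : dil d 0 p = p := dilLin_zero d p

theorem map_dil (d : ℕ) (s : ℝ) :
    Measure.map (dil d s) volume =
      ENNReal.ofReal (Real.exp (-((2 * d + 2 : ℕ) * s))) • (volume : Measure (Hd d)) := by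
  have hdet : LinearMap.det (dilLin d s : Hd d →ₗ[ℝ] Hd d) = Real.exp ((2 * d + 2 : ℕ) * s) := by
    have : (dilLin d s : Hd d →ₗ[ℝ] Hd d) = (Real.exp s • LinearMap.id).prodMap
      ((Real.exp s • LinearMap.id).prodMap (Real.exp (2 * s) • LinearMap.id)) := rfl
    rw [this, LinearMap.det_prodMap, LinearMap.det_prodMap, LinearMap.det_smul, LinearMap.det_smul]
    simp only [finrank_euclideanSpace, Fintype.card_fin, LinearMap.det_id, mul_one,
      Module.finrank_self, pow_one, ← Real.exp_nat_mul, ← Real.exp_add]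
    congr 1
    push_cast
    ring
  have h := Measure.map_linearMap_addHaar_eq_smul_addHaar (volume : Measure (Hd d))
    (f := (dilLin d s : Hd d →ₗ[ℝ] Hd d)) (by rw [hdet]; exact (Real.exp_pos _).ne')
  rw [hdet, abs_of_pos (by positivity), ← Real.exp_neg] at h
  exact h

theorem lintegral_comp_dil (d : ℕ) (s : ℝ) (F : Hd d → ℝ≥0∞) :
    ∫⁻ p, F (dil d s p) =
      ENNReal.ofReal (Real.exp (-((2 * d + 2 : ℕ) * s))) * ∫⁻ p, F p := by
  have h := lintegral_map_equiv (μ := (volume : Measure (Hd d))) F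
    (dil d s).toHomeomorph.toMeasurableEquiv
  rw [← smul_eq_mul, ← lintegral_smul_measure, ← map_dil]
  exact h.symm

theorem integral_comp_dil (d : ℕ) (s : ℝ) {G : Type*} [NormedAddCommGroup G] [NormedSpace ℝ G]
    (F : Hd d → G) :
    ∫ p, F (dil d s p) = Real.exp (-((2 * d + 2 : ℕ) * s)) • ∫ p, F p := by
  have h := integral_map_equiv (μ := (volume : Measure (Hd d)))
    (dil d s).toHomeomorph.toMeasurableEquiv F
  have h2 := integral_smul_measure (μ := (volume : Measure (Hd d))) F
    (ENNReal.ofReal (Real.exp (-((2 * d + 2 : ℕ) * s))))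
  rw [← map_dil, ENNReal.toReal_ofReal (Real.exp_pos _).le] at h2
  exact h.symm.trans h2

/-- The `L²`-normalized dilations acting on Schwartz functions. -/
def dilate (d : ℕ) (s : ℝ) : 𝓢(Hd d, ℂ) →ₗ[ℂ] 𝓢(Hd d, ℂ) :=
  (Real.exp ((d + 1) * s) : ℂ) •
    (SchwartzMap.compCLMOfContinuousLinearEquiv ℂ (dil d s)).toLinearMap

theorem dilate_apply (d : ℕ) (s : ℝ) (f : 𝓢(Hd d, ℂ)) (p : Hd d) :
    dilate d s f p = Real.exp ((d + 1) * s) * f (dil d s p) := rfl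

theorem dilate_dilate_neg (d : ℕ) (s : ℝ) (f : 𝓢(Hd d, ℂ)) :
    dilate d s (dilate d (-s) f) = f := by
  ext p
  rw [dilate_apply, dilate_apply, dil_dil, neg_add_cancel, dil_zero, ← mul_assoc,
    ← Complex.ofReal_mul, ← Real.exp_add]
  simp

theorem fderiv_dilate (d : ℕ) (s : ℝ) (f : 𝓢(Hd d, ℂ)) (p v : Hd d) :
    fderiv ℝ (dilate d s f) p v =
      Real.exp ((d + 1) * s) * fderiv ℝ f (dil d s p) (dil d s v) := by
  have h : HasFDerivAt (fun q => f (dil d s q))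
      ((fderiv ℝ f (dil d s p)).comp (dil d s : Hd d →L[ℝ] Hd d)) p :=
    (f.differentiableAt.hasFDerivAt).comp p (dil d s).hasFDerivAt
  have h2 := (h.const_mul (Real.exp ((d + 1) * s) : ℂ)).fderiv
  change fderiv ℝ (fun q => (Real.exp ((d + 1) * s) : ℂ) * f (dil d s q)) p v = _
  rw [h2]
  rfl

theorem dil_horizField (d : ℕ) (i : Fin d ⊕ Fin d) (s : ℝ) (p : Hd d) :
    dil d s (horizField d i p) = Real.exp s • horizField d i (dil d s p) := by
  cases i <;> simp [dil_apply, horizField, horizVec, horizCoeff, two_mul, Real.exp_add] <;> ring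

theorem horiz_dilate (d : ℕ) (i : Fin d ⊕ Fin d) (s : ℝ) (f : 𝓢(Hd d, ℂ)) :
    horiz d i (dilate d s f) = (Real.exp s : ℂ) • dilate d s (horiz d i f) := by
  ext p
  rw [horiz_apply, fderiv_dilate, dil_horizField, map_smul, smul_apply, dilate_apply,
    horiz_apply, Complex.real_smul, smul_eq_mul]
  ring

theorem Nop_dilate {d : ℕ} {f : 𝓢(Hd d, ℂ)} (hf : ∀ p, Nop d f p = 0) (s : ℝ) (p : Hd d) :
    Nop d (dilate d s f) p = 0 := by
  rw [Nop, fderiv_dilate]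
  have h := hf (dil d s p)
  rw [Nop] at h
  have h2 : dil d s (p.2.1, -p.1, 0) = ((dil d s p).2.1, -(dil d s p).1, 0) := by
    simp [dil_apply]
  rw [h2, h, mul_zero]

theorem integral_conj_dilate_mul_dilate (d : ℕ) (s : ℝ) (f g : 𝓢(Hd d, ℂ)) :
    ∫ p, conj (dilate d s f p) * dilate d s g p = ∫ p, conj (f p) * g p := by
  have h1 : ∀ p, conj (dilate d s f p) * dilate d s g p =
      (Real.exp ((2 * d + 2 : ℕ) * s)) • (fun q => conj (f q) * g q) (dil d s p) := fun p => by
    have he : Real.exp ((2 * d + 2 : ℕ) * s) = Real.exp ((d + 1) * s) * Real.exp ((d + 1) * s) := by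
      rw [← Real.exp_add]; congr 1; push_cast; ring
    rw [dilate_apply, dilate_apply, he, map_mul, Complex.conj_ofReal, Complex.real_smul]
    push_cast
    ring
  simp_rw [h1]
  rw [integral_smul, integral_comp_dil d s fun q => conj (f q) * g q, smul_smul, ← Real.exp_add,
    add_neg_cancel, Real.exp_zero, one_smul]

theorem norm_dil_le (d : ℕ) {s R : ℝ} (hs : |s| ≤ R) (p : Hd d) :
    ‖dil d s p‖ ≤ Real.exp (2 * R) * ‖p‖ := by
  obtain ⟨h1, h2⟩ := abs_le.1 hs
  have hR : 0 ≤ R := (abs_nonneg s).trans hs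
  have e1 : Real.exp s ≤ Real.exp (2 * R) := Real.exp_le_exp.2 (by linarith)
  have e2 : Real.exp (2 * s) ≤ Real.exp (2 * R) := Real.exp_le_exp.2 (by linarith)
  rw [dil_apply]
  refine norm_prod_le_iff.2 ⟨?_, norm_prod_le_iff.2 ⟨?_, ?_⟩⟩
  · rw [norm_smul, Real.norm_of_nonneg (Real.exp_pos _).le]
    exact mul_le_mul e1 (norm_fst_le p) (norm_nonneg _) (Real.exp_pos _).le
  · rw [norm_smul, Real.norm_of_nonneg (Real.exp_pos _).le]
    exact mul_le_mul e1 ((norm_fst_le p.2).trans (norm_snd_le p)) (norm_nonneg _)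
      (Real.exp_pos _).le
  · rw [norm_mul, Real.norm_of_nonneg (Real.exp_pos _).le]
    exact mul_le_mul e2 ((norm_snd_le p.2).trans (norm_snd_le p)) (norm_nonneg _)
      (Real.exp_pos _).le

theorem exists_integrable_bound_comp_dil (d : ℕ) (g : 𝓢(Hd d, ℂ)) (R : ℝ) :
    ∃ B : Hd d → ℝ, Integrable B ∧ ∀ s, |s| ≤ R → ∀ p, ‖g (dil d s p)‖ ≤ B p := by
  set k := (volume : Measure (Hd d)).integrablePower
  obtain ⟨C, hC⟩ : ∃ C : ℝ, ∀ p, (1 + ‖p‖) ^ k * ‖g p‖ ≤ C := by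
    have := fun p => g.one_add_le_sup_seminorm_apply (𝕜 := ℝ) (m := (k, 0)) (k := k) (n := 0)
      le_rfl le_rfl p
    simp only [norm_iteratedFDeriv_zero] at this
    exact ⟨_, this⟩
  have hC0 : 0 ≤ C := le_trans (by positivity) (hC 0)
  refine ⟨fun p => C * (Real.exp (2 * R)) ^ k * (1 + ‖p‖) ^ (-(k : ℝ)),
    (Measure.integrable_pow_neg_integrablePower volume).const_mul _, fun s hs p => ?_⟩
  have hR : 0 ≤ R := (abs_nonneg s).trans hs
  have h1 : 1 + ‖p‖ ≤ Real.exp (2 * R) * (1 + ‖dil d s p‖) := by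
    have := norm_dil_le d (s := -s) (R := R) (by rwa [abs_neg]) (dil d s p)
    rw [dil_dil, neg_add_cancel, dil_zero] at this
    have := Real.one_le_exp (x := 2 * R) (by linarith)
    linarith
  have h2 : (1 + ‖p‖) ^ k ≤ Real.exp (2 * R) ^ k * (1 + ‖dil d s p‖) ^ k := by
    rw [← mul_pow]; gcongr
  beta_reduce
  rw [Real.rpow_neg (by positivity), Real.rpow_natCast, ← div_eq_mul_inv,
    le_div_iff₀ (by positivity)]
  calc ‖g (dil d s p)‖ * (1 + ‖p‖) ^ k
      ≤ ‖g (dil d s p)‖ * (Real.exp (2 * R) ^ k * (1 + ‖dil d s p‖) ^ k) := by gcongr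
    _ = Real.exp (2 * R) ^ k * ((1 + ‖dil d s p‖) ^ k * ‖g (dil d s p)‖) := by ring
    _ ≤ Real.exp (2 * R) ^ k * C := by gcongr; exact hC _
    _ = _ := by ring

theorem hasDerivAt_comp_dil (d : ℕ) (g : 𝓢(Hd d, ℂ)) (p : Hd d) (s : ℝ) :
    HasDerivAt (fun r => g (dil d r p)) (euler d g (dil d s p)) s := by
  have h1 : HasDerivAt (fun r => Real.exp (2 * r)) (Real.exp (2 * s) * 2) s := by
    simpa using ((hasDerivAt_id s).const_mul 2).exp
  have h : HasDerivAt (fun r => dil d r p) (eulerCLM d (dil d s p)) s := by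
    have := ((Real.hasDerivAt_exp s).smul_const p.1).prodMk
      (((Real.hasDerivAt_exp s).smul_const p.2.1).prodMk (h1.mul_const p.2.2))
    refine this.congr_deriv ?_
    simp [dil_apply, eulerCLM]
    ring
  exact (g.differentiableAt.hasFDerivAt).comp_hasDerivAt s h

theorem hasDerivAt_integral_comp_dil {d : ℕ} {φ : Hd d → ℂ} (hφ : AEStronglyMeasurable φ)
    {C : ℝ} (hC : ∀ p, ‖φ p‖ ≤ C) (g : 𝓢(Hd d, ℂ)) (s : ℝ) :
    HasDerivAt (fun r => ∫ p, φ p * g (dil d r p)) (∫ p, φ p * euler d g (dil d s p)) s := by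
  obtain ⟨B, hB, hBg⟩ := exists_integrable_bound_comp_dil d (euler d g) (|s| + 1)
  obtain ⟨B', hB', hBg'⟩ := exists_integrable_bound_comp_dil d g (|s| + 1)
  have hmeas : ∀ (k : 𝓢(Hd d, ℂ)) r, AEStronglyMeasurable fun p => φ p * k (dil d r p) :=
    fun k r => hφ.mul (k.continuous.comp (dil d r).continuous).aestronglyMeasurable
  have hC0 : 0 ≤ C := (norm_nonneg _).trans (hC 0)
  refine (hasDerivAt_integral_of_dominated_loc_of_deriv_le (bound := fun p => C * B p)
    (F' := fun r p => φ p * euler d g (dil d r p)) (Metric.ball_mem_nhds s one_pos)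
    (Filter.Eventually.of_forall fun r => hmeas g r) ?_ (hmeas _ s) ?_ (hB.const_mul C) ?_).2
  · refine (hB'.const_mul C).mono' (hmeas g s) (Filter.Eventually.of_forall fun p => ?_)
    rw [norm_mul]
    exact mul_le_mul (hC p) (hBg' s (by linarith) p) (norm_nonneg _) hC0
  · refine Filter.Eventually.of_forall fun p r hr => ?_
    rw [norm_mul]
    refine mul_le_mul (hC p) (hBg r ?_ p) (norm_nonneg _) hC0
    rw [Metric.mem_ball, Real.dist_eq] at hr
    have := abs_sub_abs_le_abs_sub r s
    linarith
  · exact Filter.Eventually.of_forall fun p r _ => (hasDerivAt_comp_dil d g p r).const_mul _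

/-- The regularized squared weight `|z|² / (|z|⁴ + t² + η)`. -/
def regWeight (d : ℕ) (η : ℝ) (p : Hd d) : ℝ := zsq d p / (zsq d p ^ 2 + p.2.2 ^ 2 + η)

theorem continuous_zsq (d : ℕ) : Continuous (zsq d) := by unfold zsq; fun_prop

theorem measurable_w4 (d : ℕ) : Measurable (w4 d) := by
  have h : Continuous (zn d) := (continuous_zsq d).sqrt
  unfold w4
  exact h.measurable.div ((by fun_prop : Continuous fun p : Hd d =>
    Real.sqrt (zn d p ^ 4 + p.2.2 ^ 2)).measurable)

theorem continuous_regWeight (d : ℕ) {η : ℝ} (hη : 0 < η) : Continuous (regWeight d η) := by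
  have := continuous_zsq d
  unfold regWeight
  exact this.div (by fun_prop) fun p => by positivity

theorem regWeight_nonneg (d : ℕ) {η : ℝ} (hη : 0 < η) (p : Hd d) : 0 ≤ regWeight d η p :=
  div_nonneg (zsq_nonneg d p) (by positivity)

theorem regWeight_le (d : ℕ) {η : ℝ} (hη : 0 < η) (p : Hd d) :
    regWeight d η p ≤ 1 + η⁻¹ := by
  rw [regWeight, div_le_iff₀ (by positivity)]
  have h : (1 + η⁻¹) * (zsq d p ^ 2 + p.2.2 ^ 2 + η) =
      zsq d p ^ 2 + η⁻¹ * (zsq d p ^ 2 + p.2.2 ^ 2) + p.2.2 ^ 2 + 1 + η := by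
    field_simp; ring
  have : 0 ≤ η⁻¹ * (zsq d p ^ 2 + p.2.2 ^ 2) := by positivity
  rw [h]
  nlinarith [sq_nonneg (zsq d p - 1), sq_nonneg p.2.2, zsq_nonneg d p]

theorem regWeight_le_w4_sq (d : ℕ) {η : ℝ} (hη : 0 < η) (p : Hd d) :
    regWeight d η p ≤ w4 d p ^ 2 := by
  rw [w4_sq, regWeight]
  have := zsq_nonneg d p
  rcases this.eq_or_lt with h | h
  · simp [← h]
  · exact div_le_div_of_nonneg_left this (by positivity) (by linarith)

theorem tendsto_regWeight (d : ℕ) (p : Hd d) :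
    Filter.Tendsto (fun n : ℕ => regWeight d (1 / ((n : ℝ) + 1)) p) Filter.atTop
      (nhds (w4 d p ^ 2)) := by
  rw [w4_sq]
  unfold regWeight
  rcases (zsq_nonneg d p).eq_or_lt with h | h
  · simp [← h]
  · refine tendsto_const_nhds.div ?_ (by positivity)
    simpa using tendsto_const_nhds.add (tendsto_one_div_add_atTop_nhds_zero_nat (𝕜 := ℝ))

theorem lintegral_w4_sq_le {d : ℕ} {F : Hd d → ℝ} (hF : Measurable F) {K : ℝ≥0∞}
    (h : ∀ η > 0, ∫⁻ p, ENNReal.ofReal (regWeight d η p * F p) ≤ K) :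
    ∫⁻ p, ENNReal.ofReal (w4 d p ^ 2 * F p) ≤ K := by
  have hlim : ∀ p, Filter.liminf (fun n : ℕ =>
      ENNReal.ofReal (regWeight d (1 / ((n : ℝ) + 1)) p * F p)) Filter.atTop =
        ENNReal.ofReal (w4 d p ^ 2 * F p) := fun p =>
    ((ENNReal.continuous_ofReal.tendsto _).comp
      ((tendsto_regWeight d p).mul_const (F p))).liminf_eq
  simp_rw [← hlim]
  refine (lintegral_liminf_le fun n => ?_).trans ?_
  · exact (((continuous_regWeight d (by positivity)).measurable.mul hF)).ennreal_ofReal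
  · exact Filter.liminf_le_of_frequently_le'
      (Filter.Frequently.of_forall fun n => h _ (by positivity))

theorem zsq_dil (d : ℕ) (s : ℝ) (p : Hd d) :
    zsq d (dil d s p) = Real.exp (2 * s) * zsq d p := by
  have : Real.exp (2 * s) = Real.exp s ^ 2 := by rw [← Real.exp_nat_mul]; norm_num
  simp [zsq, dil_apply, norm_smul, this]
  ring

theorem w4_sq_dil (d : ℕ) (s : ℝ) (p : Hd d) :
    w4 d (dil d s p) ^ 2 = Real.exp (-(2 * s)) * w4 d p ^ 2 := by
  have h := Real.exp_pos (2 * s)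
  rw [w4_sq, w4_sq, zsq_dil, dil_apply, Real.exp_neg]
  rcases (zsq_nonneg d p).eq_or_lt with h0 | h0
  · simp [← h0]
  · simp only
    field_simp

theorem regWeight_dil_neg_le (d : ℕ) {η s : ℝ} (hη : 0 < η) (hs : 0 ≤ s) (p : Hd d) :
    regWeight d η (dil d (-s) p) ≤ Real.exp (2 * s) * regWeight d η p := by
  have h := Real.exp_pos (2 * s)
  have h1 : 1 ≤ Real.exp (2 * s) := Real.one_le_exp (by linarith)
  have h0 := zsq_nonneg d p
  rw [regWeight, regWeight, zsq_dil, dil_apply, mul_neg, Real.exp_neg]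
  simp only
  rw [← mul_div_assoc, div_le_div_iff₀ (by positivity) (by positivity)]
  set e := Real.exp (2 * s)
  have : e * zsq d p * ((e⁻¹ * zsq d p) ^ 2 + (e⁻¹ * p.2.2) ^ 2 + η) =
      e⁻¹ * zsq d p * (zsq d p ^ 2 + p.2.2 ^ 2 + e ^ 2 * η) := by
    field_simp
  rw [this]
  have : η ≤ e ^ 2 * η := le_mul_of_one_le_left hη.le (one_le_pow₀ h1)
  gcongr

theorem lintegral_w4_sq_dilate (d : ℕ) (s : ℝ) (u : 𝓢(Hd d, ℂ)) :
    ∫⁻ p, ENNReal.ofReal (w4 d p ^ 2 * ‖dilate d s u p‖ ^ 2) =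
      ENNReal.ofReal (Real.exp (2 * s)) * ∫⁻ p, ENNReal.ofReal (w4 d p ^ 2 * ‖u p‖ ^ 2) := by
  have h : ∀ p, ENNReal.ofReal (w4 d p ^ 2 * ‖dilate d s u p‖ ^ 2) =
      ENNReal.ofReal (Real.exp ((2 * d + 4 : ℕ) * s)) *
        ENNReal.ofReal (w4 d (dil d s p) ^ 2 * ‖u (dil d s p)‖ ^ 2) := fun p => by
    rw [← ENNReal.ofReal_mul (Real.exp_pos _).le, w4_sq_dil, dilate_apply, norm_mul, mul_pow,
      Complex.norm_real, Real.norm_of_nonneg (Real.exp_pos _).le, ← Real.exp_nat_mul]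
    have : Real.exp ((2 * d + 4 : ℕ) * s) * Real.exp (-(2 * s)) =
        Real.exp ((2 : ℕ) * ((d + 1) * s)) := by
      rw [← Real.exp_add]; congr 1; push_cast; ring
    rw [← this]
    ring_nf
  simp_rw [h]
  rw [lintegral_const_mul' _ _ ENNReal.ofReal_ne_top,
    lintegral_comp_dil d s (fun p => ENNReal.ofReal (w4 d p ^ 2 * ‖u p‖ ^ 2)), ← mul_assoc,
    ← ENNReal.ofReal_mul (Real.exp_pos _).le, ← Real.exp_add]
  congr 3
  push_cast
  ring

theorem integrable_gradHsq (d : ℕ) (v : 𝓢(Hd d, ℂ)) : Integrable (gradHsq d v) := by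
  have h : gradHsq d v = fun p => ∑ i, ‖(horiz d i v).conjMul (horiz d i v) p‖ := by
    ext p
    rw [gradHsq_eq]
    refine Finset.sum_congr rfl fun i _ => ?_
    rw [SchwartzMap.conjMul_apply, norm_mul, RCLike.norm_conj, sq]
  rw [h]
  exact integrable_finsetSum _ fun i _ => ((horiz d i v).conjMul (horiz d i v)).integrable.norm

theorem integrable_regWeight_mul (d : ℕ) {η : ℝ} (hη : 0 < η) (k : 𝓢(Hd d, ℂ)) :
    Integrable fun p => (regWeight d η p : ℂ) * k p := by
  refine k.integrable.bdd_mul (c := 1 + η⁻¹) ?_ (Filter.Eventually.of_forall fun p => ?_)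
  · exact (Complex.continuous_ofReal.comp (continuous_regWeight d hη)).aestronglyMeasurable
  · rw [Complex.norm_real, Real.norm_of_nonneg (regWeight_nonneg d hη p)]
    exact regWeight_le d hη p

theorem integrable_regWeight_mul_norm_sq (d : ℕ) {η : ℝ} (hη : 0 < η) (v : 𝓢(Hd d, ℂ)) :
    Integrable fun p => regWeight d η p * ‖v p‖ ^ 2 := by
  refine (integrable_regWeight_mul d hη (v.conjMul v)).re.congr
    (Filter.Eventually.of_forall fun p => ?_)
  simp [SchwartzMap.conjMul_apply, mul_comm (conj (v p)), Complex.mul_conj,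
    Complex.normSq_eq_norm_sq]
  left
  norm_cast

theorem euler_conjMul (d : ℕ) (v : 𝓢(Hd d, ℂ)) (p : Hd d) :
    (euler d (v.conjMul v) p).re = 2 * (conj (v p) * euler d v p).re := by
  rw [euler_apply, SchwartzMap.fderiv_conjMul, ← euler_apply, Complex.add_re]
  simp only [Complex.mul_re, Complex.conj_re, Complex.conj_im]
  ring

/-- The derivative at `0` of the regularized weighted norms along the dilations is controlled
by the scaling of the weight. -/
theorem regWeight_virial (d : ℕ) {η : ℝ} (hη : 0 < η) (v : 𝓢(Hd d, ℂ)) :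
    (d : ℝ) * ∫ p, regWeight d η p * ‖v p‖ ^ 2 ≤
      - ∫ p, regWeight d η p * (conj (v p) * euler d v p).re := by
  set A := ∫ p, regWeight d η p * ‖v p‖ ^ 2
  set F : ℝ → ℝ := fun s => ∫ p, regWeight d η p * ‖v (dil d s p)‖ ^ 2
  have hF : ∀ s, F s = (∫ p, (regWeight d η p : ℂ) * v.conjMul v (dil d s p)).re := fun s => by
    have : ∀ p, (regWeight d η p : ℂ) * v.conjMul v (dil d s p) =
        ((regWeight d η p * ‖v (dil d s p)‖ ^ 2 : ℝ) : ℂ) := fun p => by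
      rw [SchwartzMap.conjMul_apply, mul_comm (conj _), Complex.mul_conj,
        Complex.normSq_eq_norm_sq]
      norm_cast
    simp_rw [this]
    rw [integral_complex_ofReal, Complex.ofReal_re]
  have hder : HasDerivAt F (2 * ∫ p, regWeight d η p * (conj (v p) * euler d v p).re) 0 := by
    have h := hasDerivAt_integral_comp_dil (φ := fun p => (regWeight d η p : ℂ))
      (Complex.continuous_ofReal.comp (continuous_regWeight d hη)).aestronglyMeasurable
      (C := 1 + η⁻¹) (fun p => by
        rw [Complex.norm_real, Real.norm_of_nonneg (regWeight_nonneg d hη p)]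
        exact regWeight_le d hη p) (v.conjMul v) 0
    have h' := Complex.reCLM.hasFDerivAt.comp_hasDerivAt 0 h
    have hFe : F = Complex.reCLM ∘ fun r => ∫ p, (regWeight d η p : ℂ) * v.conjMul v (dil d r p) :=
      funext hF
    rw [hFe]
    refine h'.congr_deriv ?_
    simp_rw [dil_zero]
    rw [← ContinuousLinearMap.integral_comp_comm _ (integrable_regWeight_mul d hη _),
      ← integral_const_mul]
    refine integral_congr_ae (Filter.Eventually.of_forall fun p => ?_)
    simp only [Complex.reCLM_apply, Complex.re_ofReal_mul, euler_conjMul]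
    ring
  have hF0 : F 0 = A := by simp only [F, dil_zero]; rfl
  have hle : ∀ s, 0 ≤ s → F s ≤ Real.exp (-(2 * d * s)) * A := fun s hs => by
    have h1 := integral_comp_dil d s (fun p => regWeight d η (dil d (-s) p) * ‖v p‖ ^ 2)
    simp only [dil_dil, neg_add_cancel, dil_zero] at h1
    calc F s = _ := h1
      _ ≤ Real.exp (-((2 * d + 2 : ℕ) * s)) • (Real.exp (2 * s) * A) := by
        refine smul_le_smul_of_nonneg_left ?_ (Real.exp_pos _).le
        rw [← integral_const_mul]
        refine integral_mono_of_nonneg (Filter.Eventually.of_forall fun p =>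
          mul_nonneg (regWeight_nonneg d hη _) (sq_nonneg _))
          ((integrable_regWeight_mul_norm_sq d hη v).const_mul _)
          (Filter.Eventually.of_forall fun p => ?_)
        beta_reduce
        rw [← mul_assoc]
        exact mul_le_mul_of_nonneg_right (regWeight_dil_neg_le d hη hs p) (sq_nonneg _)
      _ = _ := by
        rw [smul_eq_mul, ← mul_assoc, ← Real.exp_add]
        congr 2
        push_cast
        ring
  have hexp : HasDerivAt (fun s : ℝ => Real.exp (-(2 * d * s)) * A) (-(2 * d) * A) 0 := by
    have := (((hasDerivAt_id (0 : ℝ)).const_mul (2 * d : ℝ)).neg.exp).mul_const A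
    simpa using this
  have hdiff := (hexp.sub hder).tendsto_slope_zero_right
  have := ge_of_tendsto hdiff (b := 0) (by
    filter_upwards [self_mem_nhdsWithin] with s hs
    have hs : 0 < s := hs
    simp only [zero_add, Pi.sub_apply, hF0, mul_zero, neg_zero, Real.exp_zero, one_mul, sub_self,
      sub_zero, smul_eq_mul]
    have := hle s hs.le
    exact mul_nonneg (inv_nonneg.2 hs.le) (by linarith))
  linarith

/-- Hardy's inequality for the regularized weight, on functions killed by the rotations. -/
theorem integral_regWeight_mul_norm_sq_le {d : ℕ} (hd : 1 ≤ d) {η : ℝ} (hη : 0 < η)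
    {v : 𝓢(Hd d, ℂ)} (hv : ∀ p, Nop d v p = 0) :
    ∫ p, regWeight d η p * ‖v p‖ ^ 2 ≤ ∫ p, gradHsq d v p := by
  have h1 := regWeight_virial d hη v
  have h2 : - ∫ p, regWeight d η p * (conj (v p) * euler d v p).re ≤
      ∫ p, (2⁻¹ * (regWeight d η p * ‖v p‖ ^ 2) + 2⁻¹ * gradHsq d v p) := by
    rw [← integral_neg]
    refine integral_mono ?_ (((integrable_regWeight_mul_norm_sq d hη v).const_mul _).add
      ((integrable_gradHsq d v).const_mul _)) fun p => ?_
    · refine ((integrable_regWeight_mul d hη (v.conjMul (euler d v))).re.congr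
        (Filter.Eventually.of_forall fun p => ?_)).neg
      simp [SchwartzMap.conjMul_apply]
    · have hw := regWeight_nonneg d hη p
      have h3 : regWeight d η p * ‖euler d v p‖ ^ 2 ≤ gradHsq d v p :=
        (mul_le_mul_of_nonneg_right (regWeight_le_w4_sq d hη p) (sq_nonneg _)).trans
          (w4_sq_mul_norm_euler_le (hv p))
      have h4 : -(conj (v p) * euler d v p).re ≤ ‖v p‖ * ‖euler d v p‖ := by
        refine (neg_le_abs _).trans ((Complex.abs_re_le_norm _).trans_eq ?_)
        rw [norm_mul, RCLike.norm_conj]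
      have h5 := mul_le_mul_of_nonneg_left h4 hw
      have h6 := mul_nonneg hw (sq_nonneg (‖v p‖ - ‖euler d v p‖))
      beta_reduce
      nlinarith
  rw [integral_add ((integrable_regWeight_mul_norm_sq d hη v).const_mul _)
      ((integrable_gradHsq d v).const_mul _), integral_const_mul, integral_const_mul] at h2
  have h0 : 0 ≤ ∫ p, regWeight d η p * ‖v p‖ ^ 2 := integral_nonneg fun p =>
    mul_nonneg (regWeight_nonneg d hη p) (sq_nonneg _)
  have hd' : (1 : ℝ) ≤ d := by exact_mod_cast hd
  have := mul_le_mul_of_nonneg_right hd' h0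
  linarith

theorem lintegral_w4_sq_mul_norm_sq_le {d : ℕ} (hd : 1 ≤ d)
    {v : 𝓢(Hd d, ℂ)} (hv : ∀ p, Nop d v p = 0) :
    ∫⁻ p, ENNReal.ofReal (w4 d p ^ 2 * ‖v p‖ ^ 2) ≤ ENNReal.ofReal (∫ p, gradHsq d v p) := by
  refine lintegral_w4_sq_le (F := fun p => ‖v p‖ ^ 2) (v.continuous.norm.pow 2).measurable
    fun η hη => ?_
  rw [← ofReal_integral_eq_lintegral_ofReal (integrable_regWeight_mul_norm_sq d hη v)
    (Filter.Eventually.of_forall fun p => mul_nonneg (regWeight_nonneg d hη p) (sq_nonneg _))]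
  exact ENNReal.ofReal_le_ofReal (integral_regWeight_mul_norm_sq_le hd hη hv)

theorem lintegral_w4_sq_mul_norm_euler_sq_le {d : ℕ}
    {v : 𝓢(Hd d, ℂ)} (hv : ∀ p, Nop d v p = 0) :
    ∫⁻ p, ENNReal.ofReal (w4 d p ^ 2 * ‖euler d v p‖ ^ 2) ≤
      ENNReal.ofReal (∫ p, gradHsq d v p) := by
  rw [ofReal_integral_eq_lintegral_ofReal (integrable_gradHsq d v)
    (Filter.Eventually.of_forall fun p => by rw [gradHsq_eq]; positivity)]
  exact lintegral_mono fun p => ENNReal.ofReal_le_ofReal (w4_sq_mul_norm_euler_le (hv p))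

theorem ae_w4_pos {d : ℕ} (hd : 1 ≤ d) : ∀ᵐ p : Hd d, 0 < w4 d p := by
  let j : Fin d := ⟨0, hd⟩
  let V : Submodule ℝ (Hd d) := LinearMap.ker
    ((EuclideanSpace.proj j ∘L ContinuousLinearMap.fst ℝ (EuclideanSpace ℝ (Fin d))
      (EuclideanSpace ℝ (Fin d) × ℝ)).toLinearMap : Hd d →ₗ[ℝ] ℝ)
  have hV : V ≠ ⊤ := fun h => by
    have : ((EuclideanSpace.single j 1, 0, 0) : Hd d) ∈ V := h ▸ Submodule.mem_top
    simp [V] at this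
  have := Measure.addHaar_submodule (volume : Measure (Hd d)) V hV
  filter_upwards [measure_eq_zero_iff_ae_notMem.1 this] with p hp
  have hz : 0 < zsq d p := by
    refine (zsq_nonneg d p).lt_of_ne' fun h => hp ?_
    have h1 : p.1 = 0 := by
      unfold zsq at h
      have := sq_nonneg ‖p.2.1‖
      exact norm_eq_zero.1 (pow_eq_zero_iff two_ne_zero |>.1
        (le_antisymm (by linarith) (sq_nonneg ‖p.1‖)))
    simp [V, h1]
  have hzn : 0 < zn d p := Real.sqrt_pos.2 hz
  unfold w4
  positivity

/-- The Cauchy-Schwarz inequality for the duality between the weights `w₄⁻²` and `w₄²`. -/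
theorem norm_integral_conj_mul_le {d : ℕ} (hd : 1 ≤ d) {h u : Hd d → ℂ}
    (hh : Measurable h) (hu : Measurable u) {A B : ℝ} (hA : 0 ≤ A) (hB : 0 ≤ B)
    (hhA : ∫⁻ p, ENNReal.ofReal ((w4 d p)⁻¹ ^ 2 * ‖h p‖ ^ 2) ≤ ENNReal.ofReal (A ^ 2))
    (huB : ∫⁻ p, ENNReal.ofReal (w4 d p ^ 2 * ‖u p‖ ^ 2) ≤ ENNReal.ofReal (B ^ 2)) :
    ‖∫ p, conj (h p) * u p‖ ≤ A * B := by
  have hw := measurable_w4 d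
  set a : Hd d → ℝ≥0∞ := fun p => ENNReal.ofReal ((w4 d p)⁻¹ * ‖h p‖)
  set b : Hd d → ℝ≥0∞ := fun p => ENNReal.ofReal (w4 d p * ‖u p‖)
  have hab : (fun p => ‖conj (h p) * u p‖ₑ) =ᵐ[volume] a * b := by
    filter_upwards [ae_w4_pos hd] with p hp
    rw [Pi.mul_apply, ← ENNReal.ofReal_mul (by positivity), ← ofReal_norm, norm_mul,
      RCLike.norm_conj]
    congr 1
    field_simp
  have hw0 : ∀ p, 0 ≤ w4 d p := fun p => by unfold w4 zn; positivity
  have key : ∀ {c : Hd d → ℝ} {K : ℝ}, (∀ p, 0 ≤ c p) → 0 ≤ K →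
      ∫⁻ p, ENNReal.ofReal (c p ^ 2) ≤ ENNReal.ofReal (K ^ 2) →
      (∫⁻ p, ENNReal.ofReal (c p) ^ (2 : ℝ)) ^ (1 / 2 : ℝ) ≤ ENNReal.ofReal K := by
    intro c K hc hK h
    have : ∀ p, ENNReal.ofReal (c p) ^ (2 : ℝ) = ENNReal.ofReal (c p ^ 2) := fun p => by
      rw [ENNReal.ofReal_pow (hc p)]; exact ENNReal.rpow_natCast _ 2
    simp_rw [this]
    rw [one_div, ENNReal.rpow_inv_le_iff two_pos]
    refine h.trans_eq ?_
    rw [ENNReal.ofReal_pow hK]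
    exact (ENNReal.rpow_natCast _ 2).symm
  have hA' : (∫⁻ p, a p ^ (2 : ℝ)) ^ (1 / 2 : ℝ) ≤ ENNReal.ofReal A :=
    key (fun p => mul_nonneg (inv_nonneg.2 (hw0 p)) (norm_nonneg _)) hA
      (by simpa [mul_pow] using hhA)
  have hB' : (∫⁻ p, b p ^ (2 : ℝ)) ^ (1 / 2 : ℝ) ≤ ENNReal.ofReal B :=
    key (fun p => mul_nonneg (hw0 p) (norm_nonneg _)) hB (by simpa [mul_pow] using huB)
  have : ‖∫ p, conj (h p) * u p‖ₑ ≤ ENNReal.ofReal (A * B) :=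
    calc ‖∫ p, conj (h p) * u p‖ₑ ≤ ∫⁻ p, ‖conj (h p) * u p‖ₑ := enorm_integral_le_lintegral_enorm _
      _ = ∫⁻ p, (a * b) p := lintegral_congr_ae hab
      _ ≤ _ := ENNReal.lintegral_mul_le_Lp_mul_Lq volume Real.HolderConjugate.two_two
        ((hw.inv.mul hh.norm).ennreal_ofReal.aemeasurable)
        ((hw.mul hu.norm).ennreal_ofReal.aemeasurable)
      _ ≤ ENNReal.ofReal A * ENNReal.ofReal B := mul_le_mul' hA' hB'
      _ = _ := (ENNReal.ofReal_mul hA).symm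
  rw [← ofReal_norm] at this
  exact (ENNReal.ofReal_le_ofReal_iff (mul_nonneg hA hB)).1 this

/-- The functional `v ↦ ∫ conj h * v` attached to a bounded function `h`. -/
def pairing {d : ℕ} {h : Hd d → ℂ} (hh : Measurable h) {C : ℝ} (hC : ∀ p, ‖h p‖ ≤ C) :
    𝓢(Hd d, ℂ) →ₗ[ℂ] ℂ where
  toFun v := ∫ p, conj (h p) * v p
  map_add' u v := by
    have hi : ∀ v : 𝓢(Hd d, ℂ), Integrable fun p => conj (h p) * v p := fun v =>
      v.integrable.bdd_mul (c := C) (by fun_prop)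
        (Filter.Eventually.of_forall fun p => by rw [RCLike.norm_conj]; exact hC p)
    simp only [add_apply, mul_add]
    exact integral_add (hi u) (hi v)
  map_smul' c v := by
    simp only [smul_apply, smul_eq_mul, RingHom.id_apply]
    rw [← integral_const_mul]
    refine integral_congr_ae (Filter.Eventually.of_forall fun p => ?_)
    ring

theorem pairing_apply {d : ℕ} {h : Hd d → ℂ} (hh : Measurable h) {C : ℝ}
    (hC : ∀ p, ‖h p‖ ≤ C) (v : 𝓢(Hd d, ℂ)) : pairing hh hC v = ∫ p, conj (h p) * v p := rfl

theorem hasDerivAt_pairing_dilate {d : ℕ} {h : Hd d → ℂ} (hh : Measurable h) {C : ℝ}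
    (hC : ∀ p, ‖h p‖ ≤ C) (v : 𝓢(Hd d, ℂ)) (s : ℝ) :
    HasDerivAt (fun r => pairing hh hC (dilate d r v))
      ((d + 1) * pairing hh hC (dilate d s v) + pairing hh hC (dilate d s (euler d v))) s := by
  have h1 : ∀ (u : 𝓢(Hd d, ℂ)) r, pairing hh hC (dilate d r u) =
      Real.exp ((d + 1) * r) * ∫ p, conj (h p) * u (dil d r p) := fun u r => by
    rw [pairing_apply, ← integral_const_mul]
    refine integral_congr_ae (Filter.Eventually.of_forall fun p => ?_)
    simp only [dilate_apply]
    ring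
  have h2 : HasDerivAt (fun r : ℝ => Real.exp ((d + 1) * r))
      (Real.exp ((d + 1) * s) * (d + 1)) s := by
    simpa using ((hasDerivAt_id s).const_mul (d + 1 : ℝ)).exp
  have h3 := hasDerivAt_integral_comp_dil (φ := fun p => conj (h p))
    (by fun_prop) (C := C) (fun p => by rw [RCLike.norm_conj]; exact hC p) v s
  simp_rw [h1]
  refine (h2.ofReal_comp.mul h3).congr_deriv ?_
  push_cast
  ring

section Weighted

variable {d : ℕ} {h : Hd d → ℂ} {A : ℝ} {v : 𝓢(Hd d, ℂ)}

theorem norm_pairing_dilate_le (hd : 1 ≤ d) (hh : Measurable h) {C : ℝ} (hC : ∀ p, ‖h p‖ ≤ C)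
    (hA : 0 ≤ A)
    (hhA : ∫⁻ p, ENNReal.ofReal ((w4 d p)⁻¹ ^ 2 * ‖h p‖ ^ 2) ≤ ENNReal.ofReal (A ^ 2))
    {K : ℝ} (hK : 0 ≤ K)
    (hv : ∫⁻ p, ENNReal.ofReal (w4 d p ^ 2 * ‖v p‖ ^ 2) ≤ ENNReal.ofReal (K ^ 2)) (s : ℝ) :
    ‖pairing hh hC (dilate d s v)‖ ≤ A * (Real.exp s * K) := by
  refine norm_integral_conj_mul_le hd hh (dilate d s v).continuous.measurable hA (by positivity)
    hhA ?_
  rw [lintegral_w4_sq_dilate, mul_pow, ENNReal.ofReal_mul (by positivity), ← Real.exp_nat_mul]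
  exact mul_le_mul' le_rfl hv

theorem norm_pairing_le (hd : 1 ≤ d) (hh : Measurable h) {C : ℝ} (hC : ∀ p, ‖h p‖ ≤ C)
    (hA : 0 ≤ A)
    (hhA : ∫⁻ p, ENNReal.ofReal ((w4 d p)⁻¹ ^ 2 * ‖h p‖ ^ 2) ≤ ENNReal.ofReal (A ^ 2))
    {K : ℝ} (hK : 0 ≤ K) (hvN : ∀ p, Nop d v p = 0) (hvK : ∫ p, gradHsq d v p = K ^ 2) :
    ‖pairing hh hC v‖ ≤ A * K :=
  norm_integral_conj_mul_le hd hh v.continuous.measurable hA hK hhA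
    (hvK ▸ lintegral_w4_sq_mul_norm_sq_le hd hvN)

theorem norm_pairing_dilate_sub_le (hd : 1 ≤ d) (hh : Measurable h) {C : ℝ}
    (hC : ∀ p, ‖h p‖ ≤ C) (hA : 0 ≤ A)
    (hhA : ∫⁻ p, ENNReal.ofReal ((w4 d p)⁻¹ ^ 2 * ‖h p‖ ^ 2) ≤ ENNReal.ofReal (A ^ 2))
    {K : ℝ} (hK : 0 ≤ K) (hvN : ∀ p, Nop d v p = 0) (hvK : ∫ p, gradHsq d v p = K ^ 2)
    {s : ℝ} (hs : |s| ≤ 1) :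
    ‖pairing hh hC (dilate d s v) - pairing hh hC v‖ ≤ 3 * (d + 2) * A * |s| * K := by
  have hb : ∀ r ∈ Set.Icc (-1 : ℝ) 1, ‖(d + 1) * pairing hh hC (dilate d r v) +
      pairing hh hC (dilate d r (euler d v))‖ ≤ 3 * (d + 2) * A * K := fun r hr => by
    have he : Real.exp r ≤ 3 :=
      (Real.exp_le_exp.2 hr.2).trans (Real.exp_one_lt_d9.le.trans (by norm_num))
    have h1 := norm_pairing_dilate_le hd hh hC hA hhA hK
      (hvK ▸ lintegral_w4_sq_mul_norm_sq_le hd hvN) r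
    have h2 := norm_pairing_dilate_le hd hh hC hA hhA hK
      (hvK ▸ lintegral_w4_sq_mul_norm_euler_sq_le hvN) r
    have h3 : A * (Real.exp r * K) ≤ A * (3 * K) := by gcongr
    have h4 : ‖((d : ℂ) + 1)‖ = d + 1 := by
      rw [← Nat.cast_succ, Complex.norm_natCast, Nat.cast_succ]
    calc _ ≤ ‖(d : ℂ) + 1‖ * ‖pairing hh hC (dilate d r v)‖ +
          ‖pairing hh hC (dilate d r (euler d v))‖ := by
          rw [← norm_mul]; exact norm_add_le _ _
      _ ≤ (d + 1) * (A * (3 * K)) + A * (3 * K) := by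
          rw [h4]
          gcongr
          exacts [h1.trans h3, h2.trans h3]
      _ = _ := by ring
  have h0 : dilate d 0 v = v := by ext p; simp [dilate_apply, dil_zero]
  have := (convex_Icc (-1 : ℝ) 1).norm_image_sub_le_of_norm_hasDerivWithin_le
    (fun r _ => (hasDerivAt_pairing_dilate hh hC v r).hasDerivWithinAt) hb
    (x := 0) (y := s) (by simp) (abs_le.1 hs)
  rw [h0, sub_zero, Real.norm_eq_abs] at this
  linarith

end Weighted

/-- The Schwartz functions `f` with `N f = 0`. -/
def rotationInvariant (d : ℕ) : Submodule ℂ 𝓢(Hd d, ℂ) where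
  carrier := {f | ∀ p, Nop d f p = 0}
  zero_mem' p := by
    change fderiv ℝ (fun _ : Hd d => (0 : ℂ)) p _ = 0
    simp
  add_mem' {f g} hf hg p := by
    change fderiv ℝ ((f : Hd d → ℂ) + (g : Hd d → ℂ)) p _ = 0
    rw [fderiv_add f.differentiableAt g.differentiableAt]
    exact (congrArg₂ (· + ·) (hf p) (hg p)).trans (add_zero 0)
  smul_mem' c f hf p := by
    change fderiv ℝ (c • (f : Hd d → ℂ)) p _ = 0
    rw [fderiv_const_smul f.differentiableAt]
    exact (congrArg (c • ·) (hf p)).trans (smul_zero c)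

/-- The embedding of Schwartz functions into `L²`. -/
def toL2 (d : ℕ) : 𝓢(Hd d, ℂ) →ₗ[ℂ] Lp ℂ 2 (volume : Measure (Hd d)) :=
  (SchwartzMap.toLpCLM ℂ ℂ 2 volume).toLinearMap

theorem inner_toL2 (d : ℕ) (f g : 𝓢(Hd d, ℂ)) :
    ⟪toL2 d f, toL2 d g⟫_ℂ = ∫ p, conj (f p) * g p := by
  rw [L2.inner_def]
  refine integral_congr_ae ?_
  filter_upwards [f.coeFn_toLp 2 volume, g.coeFn_toLp 2 volume] with p hf hg
  change ⟪(f.toLp 2 volume) p, (g.toLp 2 volume) p⟫_ℂ = _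
  rw [hf, hg, RCLike.inner_apply, mul_comm]

/-- The horizontal gradient as a map into `L²` vector fields. -/
def horizGrad (d : ℕ) :
    𝓢(Hd d, ℂ) →ₗ[ℂ] PiLp 2 fun _ : Fin d ⊕ Fin d => Lp ℂ 2 (volume : Measure (Hd d)) :=
  (WithLp.linearEquiv 2 ℂ _).symm.toLinearMap ∘ₗ LinearMap.pi fun i => toL2 d ∘ₗ horiz d i

theorem inner_horizGrad (d : ℕ) (f g : 𝓢(Hd d, ℂ)) :
    ⟪horizGrad d f, horizGrad d g⟫_ℂ = ∑ i, ∫ p, conj (horiz d i f p) * horiz d i g p := by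
  rw [PiLp.inner_apply]
  exact Finset.sum_congr rfl fun i _ => inner_toL2 d _ _

theorem norm_horizGrad_sq (d : ℕ) (f : 𝓢(Hd d, ℂ)) :
    ∫ p, gradHsq d f p = ‖horizGrad d f‖ ^ 2 := by
  have h : ((‖horizGrad d f‖ ^ 2 : ℝ) : ℂ) = ((∫ p, gradHsq d f p : ℝ) : ℂ) := by
    have h1 := inner_self_eq_norm_sq_to_K (𝕜 := ℂ) (horizGrad d f)
    rw [inner_horizGrad] at h1
    push_cast
    refine h1.symm.trans ?_
    have h2 : ∀ i ∈ Finset.univ, Integrable fun p => conj (horiz d i f p) * horiz d i f p :=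
      fun i _ => ((horiz d i f).conjMul (horiz d i f)).integrable
    rw [← integral_finsetSum _ h2, ← integral_complex_ofReal]
    refine integral_congr_ae (Filter.Eventually.of_forall fun p => ?_)
    simp only [gradHsq_eq, Complex.ofReal_sum]
    refine Finset.sum_congr rfl fun i _ => ?_
    rw [mul_comm, Complex.mul_conj, Complex.normSq_eq_norm_sq]
  exact_mod_cast h.symm

theorem inner_horizGrad_dilate (d : ℕ) (s : ℝ) (f g : 𝓢(Hd d, ℂ)) :
    ⟪horizGrad d (dilate d s f), horizGrad d (dilate d s g)⟫_ℂ =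
      (Real.exp (2 * s) : ℂ) * ⟪horizGrad d f, horizGrad d g⟫_ℂ := by
  rw [inner_horizGrad, inner_horizGrad, Finset.mul_sum]
  refine Finset.sum_congr rfl fun i _ => ?_
  have h := integral_conj_dilate_mul_dilate d s (horiz d i f) (horiz d i g)
  rw [← h, ← integral_const_mul]
  refine integral_congr_ae (Filter.Eventually.of_forall fun p => ?_)
  have he : Real.exp (2 * s) = Real.exp s * Real.exp s := by rw [← Real.exp_add, two_mul]
  simp only [horiz_dilate, smul_apply, smul_eq_mul, map_mul, Complex.conj_ofReal, he,
    Complex.ofReal_mul]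
  ring

/-- The weak formulation of `-(Δ_H + σ) f`. -/
theorem inner_horizGrad_sub_inner_toL2 (d : ℕ) (σ : ℂ) (f v : 𝓢(Hd d, ℂ)) :
    ⟪horizGrad d f, horizGrad d v⟫_ℂ - conj σ * ⟪toL2 d f, toL2 d v⟫_ℂ =
      ∫ p, conj ((-(∑ i, horiz d i (horiz d i f) + σ • f)) p) * v p := by
  have h : ∀ u : 𝓢(Hd d, ℂ), Integrable fun p => conj (u p) * v p := fun u =>
    (u.conjMul v).integrable
  have h1 : ∀ p, conj ((-(∑ i, horiz d i (horiz d i f) + σ • f)) p) * v p =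
      (∑ i, -(conj (horiz d i (horiz d i f) p) * v p)) - conj σ * (conj (f p) * v p) := fun p => by
    simp only [neg_apply, add_apply, smul_apply, sum_apply, smul_eq_mul, map_neg, map_add, map_sum,
      map_mul, Finset.sum_neg_distrib, ← Finset.sum_mul]
    ring
  simp_rw [h1]
  have h2 : ∀ i ∈ Finset.univ,
      Integrable fun p => -(conj (horiz d i (horiz d i f) p) * v p) := fun i _ => (h _).neg
  rw [integral_sub (integrable_finsetSum _ h2) ((h f).const_mul _),
    integral_finsetSum _ h2, integral_const_mul, inner_horizGrad, inner_toL2]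
  congr 1
  refine Finset.sum_congr rfl fun i _ => ?_
  rw [integral_conj_mul_horiz, integral_neg]

/-- The resolvent estimate tested against bounded functions, in weighted norms. -/
theorem norm_pairing_le_of_resolvent {d : ℕ} (hd : 1 ≤ d) {σ : ℂ} (hσ : σ.im ≠ 0)
    {f : 𝓢(Hd d, ℂ)} (hf : ∀ p, Nop d f p = 0) {A : ℝ} (hA : 0 ≤ A)
    (hfA : ∫⁻ p, ENNReal.ofReal ((w4 d p)⁻¹ ^ 2 * ‖subLap d f p + σ * f p‖ ^ 2) ≤
      ENNReal.ofReal (A ^ 2))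
    {h : Hd d → ℂ} (hh : Measurable h) {C : ℝ} (hC : ∀ p, ‖h p‖ ≤ C) {B : ℝ} (hB : 0 ≤ B)
    (hhB : ∫⁻ p, ENNReal.ofReal ((w4 d p)⁻¹ ^ 2 * ‖h p‖ ^ 2) ≤ ENNReal.ofReal (B ^ 2)) :
    ‖∫ p, conj (h p) * f p‖ ≤ 576 * (d + 2) ^ 2 * (A * B) := by
  set g : 𝓢(Hd d, ℂ) := -(∑ i, horiz d i (horiz d i f) + σ • f) with hg
  have hgA : ∫⁻ p, ENNReal.ofReal ((w4 d p)⁻¹ ^ 2 * ‖g p‖ ^ 2) ≤ ENNReal.ofReal (A ^ 2) := by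
    refine le_trans (le_of_eq (lintegral_congr fun p => ?_)) hfA
    rw [hg, neg_apply, norm_neg, subLap_eq]
    simp
  have hgC := g.norm_le_seminorm ℝ
  have hgm : Measurable g := g.continuous.measurable
  let S := rotationInvariant d
  let D : ℝ → S →ₗ[ℂ] S := fun s => (dilate d s).restrict fun v hv p => Nop_dilate hv s p
  have hb : ∀ {h : Hd d → ℂ} {C B : ℝ} (hh : Measurable h) (hC : ∀ p, ‖h p‖ ≤ C) (_ : 0 ≤ B)
      (_ : ∫⁻ p, ENNReal.ofReal ((w4 d p)⁻¹ ^ 2 * ‖h p‖ ^ 2) ≤ ENNReal.ofReal (B ^ 2)) (v : S),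
      ‖(pairing hh hC ∘ₗ S.subtype) v‖ ≤ 3 * (d + 2) * B * ‖(horizGrad d ∘ₗ S.subtype) v‖ := by
    intro h C B hh hC hB hhB v
    refine (norm_pairing_le hd hh hC hB hhB (norm_nonneg _) v.2 (norm_horizGrad_sq d v)).trans ?_
    refine mul_le_mul_of_nonneg_right ?_ (norm_nonneg _)
    have : (0 : ℝ) ≤ d := Nat.cast_nonneg d
    nlinarith [mul_nonneg this hB]
  have := norm_apply_le_of_dilation (toL2 d ∘ₗ S.subtype) (horizGrad d ∘ₗ S.subtype) D
    (fun s v => Subtype.ext (dilate_dilate_neg d s v))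
    (fun s u v => by
      have := integral_conj_dilate_mul_dilate d s (u : 𝓢(Hd d, ℂ)) v
      rw [← inner_toL2, ← inner_toL2] at this
      exact this)
    (fun s u v => inner_horizGrad_dilate d s u v) hσ
    (pairing hgm hgC ∘ₗ S.subtype) (pairing hh hC ∘ₗ S.subtype)
    (M₁ := 3 * (d + 2) * A) (M₂ := 3 * (d + 2) * B) (by positivity) (by positivity)
    (hb hgm hgC hA hgA)
    (fun s v hs => norm_pairing_dilate_sub_le hd hgm hgC hA hgA (norm_nonneg _) v.2
      (norm_horizGrad_sq d v) hs)
    (hb hh hC hB hhB)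
    (fun s v hs => norm_pairing_dilate_sub_le hd hh hC hB hhB (norm_nonneg _) v.2
      (norm_horizGrad_sq d v) hs)
    (f := ⟨f, hf⟩) (fun v => inner_horizGrad_sub_inner_toL2 d σ f v)
  exact this.trans_eq (by ring)

theorem lintegral_w4_inv_sq_mul_regWeight_le (d : ℕ) {η : ℝ} (hη : 0 < η) (f : 𝓢(Hd d, ℂ)) :
    ∫⁻ p, ENNReal.ofReal ((w4 d p)⁻¹ ^ 2 * ‖(regWeight d η p : ℂ) * f p‖ ^ 2) ≤
      ENNReal.ofReal (∫ p, regWeight d η p * ‖f p‖ ^ 2) := by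
  rw [ofReal_integral_eq_lintegral_ofReal (integrable_regWeight_mul_norm_sq d hη f)
    (Filter.Eventually.of_forall fun p => mul_nonneg (regWeight_nonneg d hη p) (sq_nonneg _))]
  refine lintegral_mono fun p => ENNReal.ofReal_le_ofReal ?_
  have h0 := regWeight_nonneg d hη p
  have h1 : (w4 d p)⁻¹ ^ 2 * regWeight d η p ≤ 1 := by
    rw [inv_pow]
    exact inv_mul_le_one_of_le₀ (regWeight_le_w4_sq d hη p) (sq_nonneg _)
  rw [norm_mul, Complex.norm_real, Real.norm_of_nonneg h0]
  calc _ = ((w4 d p)⁻¹ ^ 2 * regWeight d η p) * (regWeight d η p * ‖f p‖ ^ 2) := by ring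
    _ ≤ 1 * (regWeight d η p * ‖f p‖ ^ 2) := by gcongr
    _ = _ := one_mul _

theorem integral_regWeight_le_of_resolvent {d : ℕ} (hd : 1 ≤ d) {σ : ℂ} (hσ : σ.im ≠ 0)
    {f : 𝓢(Hd d, ℂ)} (hf : ∀ p, Nop d f p = 0) {A : ℝ} (hA : 0 ≤ A)
    (hfA : ∫⁻ p, ENNReal.ofReal ((w4 d p)⁻¹ ^ 2 * ‖subLap d f p + σ * f p‖ ^ 2) ≤
      ENNReal.ofReal (A ^ 2)) {η : ℝ} (hη : 0 < η) :
    ∫ p, regWeight d η p * ‖f p‖ ^ 2 ≤ (576 * (d + 2) ^ 2 * A) ^ 2 := by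
  set I := ∫ p, regWeight d η p * ‖f p‖ ^ 2 with hI
  have hI0 : 0 ≤ I := integral_nonneg fun p => mul_nonneg (regWeight_nonneg d hη p) (sq_nonneg _)
  have hW : Continuous fun p => (regWeight d η p : ℂ) :=
    Complex.continuous_ofReal.comp (continuous_regWeight d hη)
  have hbdd : ∀ p, ‖(regWeight d η p : ℂ) * f p‖ ≤ (1 + η⁻¹) * SchwartzMap.seminorm ℝ 0 0 f :=
    fun p => by
      rw [norm_mul, Complex.norm_real, Real.norm_of_nonneg (regWeight_nonneg d hη p)]
      exact mul_le_mul (regWeight_le d hη p) (f.norm_le_seminorm ℝ p) (norm_nonneg _)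
        (by positivity)
  have h1 := norm_pairing_le_of_resolvent hd hσ hf hA hfA
    (h := fun p => (regWeight d η p : ℂ) * f p) (hW.mul f.continuous).measurable hbdd
    (Real.sqrt_nonneg I)
    ((lintegral_w4_inv_sq_mul_regWeight_le d hη f).trans_eq (by rw [Real.sq_sqrt hI0]))
  have h2 : ∫ p, conj ((regWeight d η p : ℂ) * f p) * f p = (I : ℂ) := by
    rw [hI, ← integral_complex_ofReal]
    refine integral_congr_ae (Filter.Eventually.of_forall fun p => ?_)
    have h3 := Complex.mul_conj (f p)
    rw [Complex.normSq_eq_norm_sq] at h3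
    simp only [map_mul, Complex.conj_ofReal, Complex.ofReal_mul]
    rw [← h3]
    ring
  rw [h2, Complex.norm_real, Real.norm_of_nonneg hI0] at h1
  have h4 : Real.sqrt I ≤ 576 * (d + 2) ^ 2 * A := by
    rcases (Real.sqrt_nonneg I).eq_or_lt with h | h
    · rw [← h]; positivity
    · refine le_of_mul_le_mul_right ?_ h
      rw [Real.mul_self_sqrt hI0]
      linarith
  rw [← Real.sq_sqrt hI0]
  gcongr

end Heisenberg

/-- Uniform resolvent estimate `‖w₄ (L - σ)⁻¹ w₄‖ ≤ C^{1/2}` on `Ker N`,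
`L = -Δ_H`, in a priori form on Schwartz functions. -/
theorem uniform_resolvent_estimate_w4_kerN (d : ℕ) (hd : 1 ≤ d) :
    ∃ C : ℝ, 0 < C ∧ ∀ (σ : ℂ), σ.im ≠ 0 → ∀ (f : SchwartzMap (Hd d) ℂ),
      (∀ p : Hd d, Nop d (⇑f) p = 0) →
      ∫⁻ p, ENNReal.ofReal (w4 d p ^ 2 * ‖f p‖ ^ 2) ≤
        ENNReal.ofReal C *
          ∫⁻ p, ENNReal.ofReal (((w4 d p)⁻¹) ^ 2 * ‖subLap d (⇑f) p + σ * f p‖ ^ 2) := by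
  refine ⟨(576 * (d + 2) ^ 2) ^ 2, by positivity, fun σ hσ f hf => ?_⟩
  set K := ∫⁻ p, ENNReal.ofReal (((w4 d p)⁻¹) ^ 2 * ‖subLap d (⇑f) p + σ * f p‖ ^ 2) with hK
  rcases eq_or_ne K ∞ with hK' | hK'
  · rw [hK', ENNReal.mul_top (by positivity)]
    exact le_top
  refine lintegral_w4_sq_le (F := fun p => ‖f p‖ ^ 2) (f.continuous.norm.pow 2).measurable
    fun η hη => ?_
  have h1 : K = ENNReal.ofReal (Real.sqrt K.toReal ^ 2) := by
    rw [Real.sq_sqrt ENNReal.toReal_nonneg, ENNReal.ofReal_toReal hK']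
  rw [← ofReal_integral_eq_lintegral_ofReal (integrable_regWeight_mul_norm_sq d hη f)
    (Filter.Eventually.of_forall fun p => mul_nonneg (regWeight_nonneg d hη p) (sq_nonneg _)),
    h1, ← ENNReal.ofReal_mul (by positivity), ← mul_pow]
  exact ENNReal.ofReal_le_ofReal
    (integral_regWeight_le_of_resolvent hd hσ hf (Real.sqrt_nonneg _) (hK ▸ h1.le) hη)
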